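/- arXiv:1205.6757 — 2 statements merged into one kernel-verified Lean document; each statement's English description precedes it below -/
import Mathlib

section
/- Let X be a finite set of distinct points in ℙ¹×ℙ¹ over k. Then X is arithmetically Cohen–Macaulay (i.e., depth(R/I_X) = 2) if and only if for every point P ∈ X the set deg_X(P) consists of exactly one element. -/
/-- `ℙ¹` over `k`, as the projectivization of `k²`. -/
abbrev Proj1 (k : Type*) [Field k] := Projectivization k (Fin 2 → k)

/-- The bigraded coordinate ring `R = k[x₀,x₁,y₀,y₁]` of `ℙ¹ × ℙ¹`,
with the `x` variables indexed by `Sum.inl` and the `y` variables by `Sum.inr`. -/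
abbrev BiPoly (k : Type*) [Field k] := MvPolynomial (Fin 2 ⊕ Fin 2) k

variable {k : Type*} [Field k]

/-- `F` is bihomogeneous of bidegree `d = (d₁, d₂)`: every monomial of `F` has total degree
`d₁` in `x₀,x₁` and total degree `d₂` in `y₀,y₁`. -/
def IsBihomogeneous (F : BiPoly k) (d : ℕ × ℕ) : Prop :=
  ∀ m ∈ F.support,
    (∑ i : Fin 2, m (Sum.inl i)) = d.1 ∧ (∑ i : Fin 2, m (Sum.inr i)) = d.2

/-- `F` vanishes at the point `P` of `ℙ¹ × ℙ¹`, i.e. at every pair of representatives. -/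
def VanishesAt (F : BiPoly k) (P : Proj1 k × Proj1 k) : Prop :=
  ∀ (p q : Fin 2 → k) (hp : p ≠ 0) (hq : q ≠ 0),
    Projectivization.mk k p hp = P.1 → Projectivization.mk k q hq = P.2 →
    MvPolynomial.eval (Sum.elim p q) F = 0

/-- `F` is a separator of `P` in `X` of bidegree `d`: it is bihomogeneous of bidegree `d`,
does not vanish at `P`, and vanishes at every other point of `X`. -/
def IsSeparator (X : Finset (Proj1 k × Proj1 k)) (P : Proj1 k × Proj1 k)
    (F : BiPoly k) (d : ℕ × ℕ) : Prop :=
  IsBihomogeneous F d ∧ ¬ VanishesAt F P ∧ ∀ Q ∈ X, Q ≠ P → VanishesAt F Q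

/-- The set of bidegrees of separators of `P` in `X`. -/
def sepDegrees (X : Finset (Proj1 k × Proj1 k)) (P : Proj1 k × Proj1 k) : Set (ℕ × ℕ) :=
  {d | ∃ F : BiPoly k, IsSeparator X P F d}

/-- `deg_X(P)`: the set of minimal elements, with respect to the componentwise partial
order on `ℕ × ℕ`, of the set of bidegrees of separators of `P` in `X`. -/
def degSet (X : Finset (Proj1 k × Proj1 k)) (P : Proj1 k × Proj1 k) : Set (ℕ × ℕ) :=
  {d | d ∈ sepDegrees X P ∧ ∀ e ∈ sepDegrees X P, e ≤ d → e = d}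

/-- The ideal `I_X` of all polynomials vanishing at (every representative of)
every point of `X`. -/
noncomputable def vanishingIdeal (X : Finset (Proj1 k × Proj1 k)) : Ideal (BiPoly k) where
  carrier := {F | ∀ P ∈ X, VanishesAt F P}
  zero_mem' := by
    intro P _ p q hp hq _ _
    simp
  add_mem' := by
    intro F G hF hG P hP p q hp hq h1 h2
    have h := hF P hP p q hp hq h1 h2
    have h' := hG P hP p q hp hq h1 h2
    simp [h, h']
  smul_mem' := by
    intro c F hF P hP p q hp hq h1 h2
    have h := hF P hP p q hp hq h1 h2
    simp [smul_eq_mul, h]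

/-- Property (*): whenever `P×Q, P'×Q' ∈ X` with `P ≠ P'` and `Q ≠ Q'`, at least one of
`P×Q'` and `P'×Q` is in `X`. -/
def PropertyStar (X : Finset (Proj1 k × Proj1 k)) : Prop :=
  ∀ P Q P' Q' : Proj1 k, (P, Q) ∈ X → (P', Q') ∈ X → P ≠ P' → Q ≠ Q' →
    (P, Q') ∈ X ∨ (P', Q) ∈ X

/-- The depth of a commutative ring `A` with respect to an ideal `m`: the supremum of the
lengths of regular sequences on `A` consisting of elements of `m`. -/
noncomputable def depthWrt (A : Type*) [CommRing A] (m : Ideal A) : ℕ :=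
  sSup {n | ∃ rs : List A, rs.length = n ∧ (∀ r ∈ rs, r ∈ m) ∧
    RingTheory.Sequence.IsRegular A rs}

/-- The irrelevant maximal ideal `(x₀,x₁,y₀,y₁)` of `R/I_X`. -/
noncomputable def irrelevantIdeal (X : Finset (Proj1 k × Proj1 k)) :
    Ideal (BiPoly k ⧸ vanishingIdeal X) :=
  (Ideal.span (Set.range (MvPolynomial.X : (Fin 2 ⊕ Fin 2) → BiPoly k))).map
    (Ideal.Quotient.mk (vanishingIdeal X))

/-- `X` is arithmetically Cohen–Macaulay: `depth (R/I_X) = 2`. -/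
def IsACM (X : Finset (Proj1 k × Proj1 k)) : Prop :=
  depthWrt (BiPoly k ⧸ vanishingIdeal X) (irrelevantIdeal X) = 2

open Classical in
/-- The number of points of `X` with first coordinate `P` (the cardinality of `X_{P,1}`). -/
noncomputable def fiber1Card (X : Finset (Proj1 k × Proj1 k)) (P : Proj1 k) : ℕ :=
  (X.filter fun T => T.1 = P).card

open Classical in
/-- The number of points of `X` with second coordinate `Q` (the cardinality of `X_{Q,2}`). -/
noncomputable def fiber2Card (X : Finset (Proj1 k × Proj1 k)) (Q : Proj1 k) : ℕ :=
  (X.filter fun T => T.2 = Q).card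

open Classical in
/-- The number of distinct first coordinates of points of `X`, i.e. `|π₁(X)|`. -/
noncomputable def proj1Card (X : Finset (Proj1 k × Proj1 k)) : ℕ :=
  (X.image Prod.fst).card

open Classical in
/-- The number of distinct second coordinates of points of `X`, i.e. `|π₂(X)|`. -/
noncomputable def proj2Card (X : Finset (Proj1 k × Proj1 k)) : ℕ :=
  (X.image Prod.snd).card


section

open MvPolynomial
open scoped Pointwise

theorem krull_bound {A : Type*} [CommRing A] (M : Type*) [AddCommGroup M] [Module A M]
    [Module.Finite A M] (rs : List A) (h : RingTheory.Sequence.IsRegular M rs) :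
    (rs.length : WithBot ℕ∞) ≤ Module.supportDim A M := by
  induction rs generalizing M with
  | nil =>
    have := h.nontrivial
    have h1 := (Module.supportDim_ne_bot_iff_nontrivial A M).2 this
    simp only [List.length_nil, Nat.cast_zero]
    obtain ⟨n, hn⟩ := WithBot.ne_bot_iff_exists.1 h1
    rw [← hn]
    exact WithBot.coe_le_coe.mpr zero_le
  | cons r rs ih =>
    rw [RingTheory.Sequence.isRegular_cons_iff] at h
    have h1 := ih _ h.2
    have h2 := Module.supportDim_quotSMulTop_succ_le_of_notMem_minimalPrimes (R := A) (M := M)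
      (x := r) (fun _ => h.1.notMem_of_mem_minimalPrimes)
    refine le_trans ?_ h2
    simp only [List.length_cons, Nat.cast_add, Nat.cast_one]
    gcongr

theorem krull_integral {A B : Type*} [CommRing A] [CommRing B] (f : A →+* B) (hf : f.IsIntegral) :
    ringKrullDim B ≤ ringKrullDim A := by
  algebraize [f]
  refine Order.krullDim_le_of_strictMono (fun p => PrimeSpectrum.comap f p) ?_
  intro p q hpq
  have : p.asIdeal < q.asIdeal := hpq
  exact Ideal.IsIntegral.comap_lt_comap (R := A) this

theorem regular_pair_iff {A : Type*} [CommRing A] (a b : A) :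
    RingTheory.Sequence.IsWeaklyRegular A [a, b] ↔
      (∀ z, a * z = 0 → z = 0) ∧ (∀ z w, b * z = a * w → ∃ e, z = a * e) := by
  simp only [RingTheory.Sequence.isWeaklyRegular_cons_iff, RingTheory.Sequence.IsWeaklyRegular.nil,
    and_true]
  have mem : ∀ z : A, z ∈ a • (⊤ : Submodule A A) ↔ ∃ e, z = a * e := by
    intro z
    rw [Submodule.mem_smul_pointwise_iff_exists]
    simp [eq_comm]
  refine and_congr ?_ ?_
  · rw [isSMulRegular_iff_right_eq_zero_of_smul]; rfl
  · rw [isSMulRegular_quotient_iff_mem_of_smul_mem]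
    simp only [mem, smul_eq_mul]
    constructor
    · intro h z w hz
      exact h z ⟨w, hz⟩
    · rintro h z ⟨w, hz⟩
      exact h z w hz

theorem depth_colon {A : Type*} [CommRing A] (m : Ideal A) (hm : m.FG) (a b s c : A)
    (ha : a ∈ m) (hb : b ∈ m)
    (hreg : RingTheory.Sequence.IsWeaklyRegular A [a, b]) (hs : ∀ z, s * z = 0 → z = 0)
    (J : Ideal A) (hJ : ∀ r ∈ J, s ∣ r * c) (hmJ : m ≤ J.radical) : s ∣ c := by
  rw [regular_pair_iff] at hreg
  obtain ⟨n, hn⟩ := Ideal.exists_pow_le_of_le_radical_of_fg hmJ hm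
  have key : ∀ c, s ∣ a * c → s ∣ b * c → s ∣ c := by
    rintro c ⟨e, he⟩ ⟨f, hf⟩
    have h1 : b * e = a * f := by
      have := hs (b * e - a * f) (by linear_combination (-b) * he + a * hf)
      exact sub_eq_zero.1 this
    obtain ⟨e', rfl⟩ := hreg.2 _ _ h1
    refine ⟨e', ?_⟩
    have := hreg.1 (c - s * e') (by linear_combination he)
    exact sub_eq_zero.1 this
  have : ∀ j, j ≤ n → ∀ r ∈ m ^ (n - j), s ∣ r * c := by
    intro j
    induction j with
    | zero => intro _ r hr; exact hJ r (hn hr)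
    | succ j ih =>
      intro hj r hr
      have e : n - j = n - (j + 1) + 1 := by omega
      apply key
      · rw [← mul_assoc]; refine ih (by omega) _ ?_
        rw [e, pow_succ']; exact Ideal.mul_mem_mul ha hr
      · rw [← mul_assoc]; refine ih (by omega) _ ?_
        rw [e, pow_succ']; exact Ideal.mul_mem_mul hb hr
  simpa using this n le_rfl 1 (by simp)

/-- restriction to the plane over a point -/
noncomputable def phi (P : Proj1 k × Proj1 k) : BiPoly k →ₐ[k] MvPolynomial (Fin 2) k :=
  aeval (Sum.elim (fun i => C (P.1.rep i) * X 0) (fun j => C (P.2.rep j) * X 1))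

theorem eval_phi (P : Proj1 k × Proj1 k) (F : BiPoly k) (v : Fin 2 → k) :
    eval v (phi P F) = eval (Sum.elim (v 0 • P.1.rep) (v 1 • P.2.rep)) F := by
  have : (aeval v : MvPolynomial (Fin 2) k →ₐ[k] k).comp (phi P) =
      (aeval (Sum.elim (v 0 • P.1.rep) (v 1 • P.2.rep)) : BiPoly k →ₐ[k] k) := by
    apply MvPolynomial.algHom_ext
    rintro (i | i) <;> simp [phi, mul_comm]
  have h := DFunLike.congr_fun this F
  simpa [MvPolynomial.aeval_eq_eval] using h

theorem rep_mk (P : Proj1 k) (p : Fin 2 → k) (hp : p ≠ 0) :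
    Projectivization.mk k p hp = P ↔ ∃ c : k, c ≠ 0 ∧ p = c • P.rep := by
  constructor
  · intro h
    obtain ⟨a, ha⟩ := Projectivization.exists_smul_eq_mk_rep k p hp
    rw [h] at ha
    refine ⟨(a⁻¹ : kˣ), by simp, ?_⟩
    rw [← ha]
    change p = (a⁻¹ : kˣ) • (a • p)
    simp
  · rintro ⟨c, hc, h⟩
    conv_rhs => rw [← P.mk_rep]
    rw [Projectivization.mk_eq_mk_iff']
    exact ⟨c, h.symm⟩

theorem vanishes_iff [Infinite k] (P : Proj1 k × Proj1 k) (F : BiPoly k) :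
    VanishesAt F P ↔ phi P F = 0 := by
  constructor
  · intro h
    have h0 : X 0 * X 1 * phi P F = 0 := by
      apply MvPolynomial.funext
      intro v
      simp only [map_mul, eval_X, map_zero]
      by_cases h0 : v 0 = 0
      · simp [h0]
      by_cases h1 : v 1 = 0
      · simp [h1]
      rw [eval_phi, h (v 0 • P.1.rep) (v 1 • P.2.rep)
        (smul_ne_zero h0 P.1.rep_nonzero) (smul_ne_zero h1 P.2.rep_nonzero), mul_zero]
      · rw [rep_mk]; exact ⟨_, h0, rfl⟩
      · rw [rep_mk]; exact ⟨_, h1, rfl⟩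
    simpa using h0
  · intro h p q hp hq h1 h2
    rw [rep_mk] at h1 h2
    obtain ⟨a, ha, rfl⟩ := h1
    obtain ⟨b, hb, rfl⟩ := h2
    have := eval_phi P F ![a, b]
    rw [h] at this
    simpa using this.symm

theorem mem_vI [Infinite k] (Y : Finset (Proj1 k × Proj1 k)) (F : BiPoly k) :
    F ∈ vanishingIdeal Y ↔ ∀ P ∈ Y, phi P F = 0 := by
  change (∀ P ∈ Y, VanishesAt F P) ↔ _
  simp only [vanishes_iff]

/-- exponent -/
noncomputable def ex (d : ℕ × ℕ) : Fin 2 →₀ ℕ := Finsupp.single 0 d.1 + Finsupp.single 1 d.2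

theorem ex_inj {d e : ℕ × ℕ} (h : ex d = ex e) : d = e := by
  have h0 := DFunLike.congr_fun h 0
  have h1 := DFunLike.congr_fun h 1
  simp [ex] at h0 h1
  exact Prod.ext h0 h1

theorem ex_surj (m : Fin 2 →₀ ℕ) : m = ex (m 0, m 1) := by
  ext i; fin_cases i <;> simp [ex]

theorem phi_monomial (P : Proj1 k × Proj1 k) (m : Fin 2 ⊕ Fin 2 →₀ ℕ) (c : k) :
    ∃ c', phi P (monomial m c) =
      monomial (ex (∑ i : Fin 2, m (Sum.inl i), ∑ i : Fin 2, m (Sum.inr i))) c' := by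
  refine ⟨c * ((P.1.rep 0 ^ m (Sum.inl 0) * P.1.rep 1 ^ m (Sum.inl 1)) *
    (P.2.rep 0 ^ m (Sum.inr 0) * P.2.rep 1 ^ m (Sum.inr 1))), ?_⟩
  rw [phi, aeval_monomial, Finsupp.prod_fintype _ _ (by simp)]
  rw [← mul_one (monomial _ _), monomial_eq]
  rw [Finsupp.prod_fintype _ _ (by simp)]
  simp [ex, Fin.sum_univ_two, algebraMap_eq]
  ring

theorem bihom_zero (d : ℕ × ℕ) : IsBihomogeneous (0 : BiPoly k) d := by
  intro m hm; simp at hm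

theorem bihom_add {F G : BiPoly k} {d : ℕ × ℕ} (hF : IsBihomogeneous F d)
    (hG : IsBihomogeneous G d) : IsBihomogeneous (F + G) d := by
  classical
  intro m hm
  rcases Finset.mem_union.1 (support_add hm) with h | h
  · exact hF m h
  · exact hG m h

theorem bihom_mul {F G : BiPoly k} {d e : ℕ × ℕ} (hF : IsBihomogeneous F d)
    (hG : IsBihomogeneous G e) : IsBihomogeneous (F * G) (d + e) := by
  classical
  intro m hm
  obtain ⟨a, ha, b, hb, rfl⟩ := Finset.mem_add.1 (support_mul F G hm)
  have h1 := hF a ha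
  have h2 := hG b hb
  simp only [Finsupp.add_apply, Finset.sum_add_distrib, Prod.fst_add, Prod.snd_add]
  omega

theorem bihom_one : IsBihomogeneous (1 : BiPoly k) 0 := by
  classical
  intro m hm
  rw [mem_support_iff, coeff_one] at hm
  have : m = 0 := by
    by_contra h
    exact hm (if_neg (fun h' => h h'.symm))
  simp [this]

theorem bihom_prod {ι : Type*} (S : Finset ι) (f : ι → BiPoly k) (d : ℕ × ℕ)
    (h : ∀ i ∈ S, IsBihomogeneous (f i) d) : IsBihomogeneous (∏ i ∈ S, f i) (S.card • d) := by
  classical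
  induction S using Finset.induction_on with
  | empty => simpa using bihom_one
  | insert a S ha ih =>
    rw [Finset.prod_insert ha, Finset.card_insert_of_notMem ha, add_comm, add_smul, one_smul]
    exact bihom_mul (h a (by simp)) (ih fun i hi => h i (by simp [hi]))

theorem bihom_phi {F : BiPoly k} {d : ℕ × ℕ} (hF : IsBihomogeneous F d) (P : Proj1 k × Proj1 k) :
    ∃ c, phi P F = monomial (ex d) c := by
  choose c hc using fun m => phi_monomial P m (coeff m F)
  refine ⟨∑ m ∈ F.support, c m, ?_⟩
  conv_lhs => rw [F.as_sum]
  rw [map_sum, map_sum]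
  refine Finset.sum_congr rfl fun m hm => ?_
  rw [hc, (hF m hm).1, (hF m hm).2]

theorem component (F : BiPoly k) (d : ℕ × ℕ) : ∃ G : BiPoly k, IsBihomogeneous G d ∧
    ∀ P, phi P G = monomial (ex d) (coeff (ex d) (phi P F)) := by
  classical
  induction F using MvPolynomial.induction_on' with
  | monomial m c =>
    by_cases h : (∑ i : Fin 2, m (Sum.inl i), ∑ i : Fin 2, m (Sum.inr i)) = d
    · refine ⟨monomial m c, ?_, ?_⟩
      · intro m' hm'
        have := support_monomial_subset hm'
        simp only [Finset.mem_singleton] at this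
        subst this; subst h; simp
      · intro P
        obtain ⟨c', hc'⟩ := phi_monomial P m c
        rw [hc', h]; simp
    · refine ⟨0, bihom_zero d, ?_⟩
      intro P
      obtain ⟨c', hc'⟩ := phi_monomial P m c
      rw [hc', coeff_monomial, if_neg (fun h' => h (ex_inj h'))]; simp
  | add F G hF hG =>
    obtain ⟨F', h1, h2⟩ := hF
    obtain ⟨G', h3, h4⟩ := hG
    exact ⟨F' + G', bihom_add h1 h3, fun P => by simp [h2, h4]⟩

/-- determinant of two points -/
noncomputable def dt (P Q : Proj1 k) : k := P.rep 1 * Q.rep 0 - P.rep 0 * Q.rep 1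

theorem dt_eq_zero (P Q : Proj1 k) : dt P Q = 0 ↔ P = Q := by
  constructor
  · intro h
    have hP := P.rep_nonzero
    have hQ := Q.rep_nonzero
    rw [← P.mk_rep, rep_mk]
    unfold dt at h
    by_cases h0 : Q.rep 0 = 0
    · have h1 : Q.rep 1 ≠ 0 := fun h1 => hQ (by ext i; fin_cases i <;> simp [h0, h1])
      have h2 : P.rep 0 = 0 := by simpa [h0, h1] using h
      have h3 : P.rep 1 ≠ 0 := fun h1 => hP (by ext i; fin_cases i <;> simp [h2, h1])
      refine ⟨P.rep 1 / Q.rep 1, div_ne_zero h3 h1, ?_⟩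
      ext i; fin_cases i
      · simp [h0, h2]
      · simp; field_simp
    · have h2 : P.rep 0 ≠ 0 := by
        intro h2
        have h3 : P.rep 1 = 0 := by simpa [h0, h2] using h
        exact hP (by ext i; fin_cases i <;> simp [h2, h3])
      refine ⟨P.rep 0 / Q.rep 0, div_ne_zero h2 h0, ?_⟩
      ext i; fin_cases i
      · simp; field_simp
      · simp; field_simp; linear_combination h
  · rintro rfl; unfold dt; ring

noncomputable def vX (P : Proj1 k) : BiPoly k :=
  C (P.rep 1) * X (Sum.inl 0) - C (P.rep 0) * X (Sum.inl 1)
noncomputable def vY (P : Proj1 k) : BiPoly k :=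
  C (P.rep 1) * X (Sum.inr 0) - C (P.rep 0) * X (Sum.inr 1)

theorem phi_vX (P : Proj1 k) (T : Proj1 k × Proj1 k) : phi T (vX P) = C (dt P T.1) * X 0 := by
  simp [phi, vX, dt, algebraMap_eq]; ring
theorem phi_vY (P : Proj1 k) (T : Proj1 k × Proj1 k) : phi T (vY P) = C (dt P T.2) * X 1 := by
  simp [phi, vY, dt, algebraMap_eq]; ring

theorem bihom_CX (c : k) (s : Fin 2 ⊕ Fin 2) :
    IsBihomogeneous (C c * X s : BiPoly k) (Sum.elim (fun _ => (1, 0)) (fun _ => (0, 1)) s) := by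
  classical
  intro m hm
  rw [C_mul_X_eq_monomial] at hm
  have := support_monomial_subset hm
  simp only [Finset.mem_singleton] at this
  subst this
  rcases s with i | i <;> fin_cases i <;> simp

theorem bihom_vX (P : Proj1 k) : IsBihomogeneous (vX P) (1, 0) := by
  rw [vX, sub_eq_add_neg, ← neg_mul, ← C_neg]
  exact bihom_add (bihom_CX _ (Sum.inl 0)) (bihom_CX _ (Sum.inl 1))
theorem bihom_vY (P : Proj1 k) : IsBihomogeneous (vY P) (0, 1) := by
  rw [vY, sub_eq_add_neg, ← neg_mul, ← C_neg]
  exact bihom_add (bihom_CX _ (Sum.inr 0)) (bihom_CX _ (Sum.inr 1))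

theorem proj1_infinite [Infinite k] : Infinite (Proj1 k) := by
  have hne : ∀ t : k, (![1, t] : Fin 2 → k) ≠ 0 := fun t h => by
    have := congrFun h 0; simp at this
  refine Infinite.of_injective (fun t : k => Projectivization.mk k ![1, t] (hne t)) ?_
  intro s t h
  simp only [Projectivization.mk_eq_mk_iff'] at h
  obtain ⟨a, ha⟩ := h
  have h0 := congrFun ha 0
  have h1 := congrFun ha 1
  simp at h0 h1
  rw [← h1, h0, one_mul]

theorem exists_notMem_proj [Infinite k] (S : Finset (Proj1 k)) : ∃ P, P ∉ S := by
  have := proj1_infinite (k := k)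
  exact Infinite.exists_notMem_finset S

theorem eval_aeval_mv {σ τ : Type*} (g : σ → MvPolynomial τ k) (v : τ → k) (F : MvPolynomial σ k) :
    eval v (aeval g F) = eval (fun i => eval v (g i)) F := by
  induction F using MvPolynomial.induction_on with
  | C a => simp
  | add p q hp hq => simp only [map_add, hp, hq]
  | mul_X p i hp => simp only [map_mul, hp, aeval_X, eval_X]

theorem eval_aeval_poly {σ : Type*} (g : σ → Polynomial k) (v : k) (F : MvPolynomial σ k) :
    Polynomial.eval v (aeval g F) = eval (fun i => Polynomial.eval v (g i)) F := by
  induction F using MvPolynomial.induction_on with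
  | C a => simp
  | add p q hp hq => simp only [map_add, Polynomial.eval_add, hp, hq]
  | mul_X p i hp => simp only [map_mul, Polynomial.eval_mul, hp, aeval_X, eval_X]

theorem binary_bound [Infinite k] (G : MvPolynomial (Fin 2) k) (a : ℕ) (hG : G.totalDegree ≤ a)
    (S : Finset (Proj1 k)) (hS : ∀ s ∈ S, ∀ c : k, c ≠ 0 → eval (c • s.rep) G = 0)
    (haS : a < S.card) (P : Proj1 k) : eval P.rep G = 0 := by
  classical
  by_cases hP : P ∈ S
  · simpa using hS P hP 1 one_ne_zero
  by_contra hne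
  obtain ⟨Z, hZ⟩ := exists_notMem_proj (insert P S)
  simp only [Finset.mem_insert, not_or] at hZ
  obtain ⟨hZP, hZS⟩ := hZ
  let f : Polynomial k := aeval (fun i => Polynomial.C (P.rep i) + Polynomial.X * Polynomial.C (Z.rep i)) G
  have hf : ∀ T : k, f.eval T = eval (P.rep + T • Z.rep) G := by
    intro T
    have := eval_aeval_poly (fun i => Polynomial.C (P.rep i) + Polynomial.X * Polynomial.C (Z.rep i)) T G
    rw [this]
    congr 2
    ext i
    simp only [Polynomial.eval_add, Polynomial.eval_mul, Polynomial.eval_C, Polynomial.eval_X,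
      Pi.add_apply, Pi.smul_apply, smul_eq_mul]
  have hdeg : f.natDegree ≤ a := by
    have := MvPolynomial.aeval_natDegree_le (n := 1) G hG
      (fun i => Polynomial.C (P.rep i) + Polynomial.X * Polynomial.C (Z.rep i)) (by
        intro i
        refine (Polynomial.natDegree_add_le _ _).trans ?_
        refine max_le (by simp) ?_
        refine (Polynomial.natDegree_mul_le).trans ?_
        simp)
    rw [mul_one] at this
    exact this
  have hf0 : f ≠ 0 := by
    intro h0
    apply hne
    have := hf 0
    simpa [h0] using this.symm
  have hPZ : dt P Z ≠ 0 := fun h => hZP ((dt_eq_zero _ _).1 h).symm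
  let t : Proj1 k → k := fun s => dt P s / dt s Z
  have hsZ : ∀ s ∈ S, dt s Z ≠ 0 := fun s hs h => hZS ((dt_eq_zero _ _).1 h ▸ hs)
  have hcomb : ∀ s ∈ S, P.rep + t s • Z.rep = (dt P Z / dt s Z) • s.rep := by
    intro s hs
    have h1 := hsZ s hs
    ext i
    simp only [t, Pi.add_apply, Pi.smul_apply, smul_eq_mul]
    field_simp
    fin_cases i <;> simp [dt] <;> ring
  have hroots : S.image t ⊆ f.roots.toFinset := by
    intro T hT
    obtain ⟨s, hs, rfl⟩ := Finset.mem_image.1 hT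
    rw [Multiset.mem_toFinset, Polynomial.mem_roots hf0, Polynomial.IsRoot, hf, hcomb s hs]
    exact hS s hs _ (div_ne_zero hPZ (hsZ s hs))
  have hinj : Set.InjOn t S := by
    intro s hs s' hs' h
    have h1 := hcomb s hs
    rw [h, hcomb s' hs'] at h1
    have hc := div_ne_zero hPZ (hsZ s hs)
    have hc' := div_ne_zero hPZ (hsZ s' hs')
    rw [← s.mk_rep, rep_mk]
    refine ⟨(dt P Z / dt s Z)⁻¹ * (dt P Z / dt s' Z), mul_ne_zero (inv_ne_zero hc) hc', ?_⟩
    rw [mul_smul, h1, smul_smul, inv_mul_cancel₀ hc, one_smul]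
  have h1 := Finset.card_le_card hroots
  rw [Finset.card_image_of_injOn hinj] at h1
  have h2 := Multiset.toFinset_card_le f.roots
  have h3 := Polynomial.card_roots' f
  omega

theorem not_vanish_rep [Infinite k] {F : BiPoly k} {d : ℕ × ℕ} (hF : IsBihomogeneous F d)
    (T : Proj1 k × Proj1 k) : VanishesAt F T ↔ eval (Sum.elim T.1.rep T.2.rep) F = 0 := by
  rw [vanishes_iff]
  obtain ⟨c, hc⟩ := bihom_phi hF T
  have h := eval_phi T F 1
  simp only [Pi.one_apply, one_smul] at h
  rw [← h, hc]
  simp [eval_monomial]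

theorem xbound [Infinite k] {F : BiPoly k} {d : ℕ × ℕ} (hF : IsBihomogeneous F d) (Q : Proj1 k)
    (S : Finset (Proj1 k)) (hS : d.1 < S.card) (h : ∀ s ∈ S, VanishesAt F (s, Q)) (P : Proj1 k) :
    VanishesAt F (P, Q) := by
  rw [not_vanish_rep hF]
  let G : MvPolynomial (Fin 2) k := aeval (Sum.elim X (fun j => C (Q.rep j))) F
  have hG : ∀ v, eval v G = eval (Sum.elim v Q.rep) F := by
    intro v
    have := eval_aeval_mv (Sum.elim X (fun j => C (Q.rep j))) v F
    rw [this]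
    congr 2
    ext (i | i) <;> simp
  have hd : G.totalDegree ≤ d.1 := by
    simp only [G]
    conv_lhs => rw [F.as_sum, map_sum]
    refine totalDegree_finsetSum_le fun m hm => ?_
    rw [aeval_monomial, Finsupp.prod_fintype _ _ (by simp)]
    simp only [Fintype.prod_sum_type, Sum.elim_inl, Sum.elim_inr, algebraMap_eq, ← C_pow, ← map_prod]
    rw [mul_comm (∏ _, _), ← mul_assoc, ← C_mul]
    rw [← (hF m hm).1]
    refine (totalDegree_mul _ _).trans ?_
    refine (Nat.add_le_add le_rfl (totalDegree_finsetProd _ _)).trans ?_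
    rw [totalDegree_C, zero_add]
    exact Finset.sum_le_sum fun i _ => (totalDegree_X_pow _ _).le
  rw [← hG]
  refine binary_bound G d.1 hd S ?_ hS P
  intro s hs c hc
  rw [hG]
  exact h s hs _ _ (smul_ne_zero hc s.rep_nonzero) Q.rep_nonzero
    ((rep_mk _ _ _).2 ⟨c, hc, rfl⟩) (Projectivization.mk_rep _)

theorem ybound [Infinite k] {F : BiPoly k} {d : ℕ × ℕ} (hF : IsBihomogeneous F d) (P : Proj1 k)
    (S : Finset (Proj1 k)) (hS : d.2 < S.card) (h : ∀ s ∈ S, VanishesAt F (P, s)) (Q : Proj1 k) :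
    VanishesAt F (P, Q) := by
  rw [not_vanish_rep hF]
  let G : MvPolynomial (Fin 2) k := aeval (Sum.elim (fun j => C (P.rep j)) X) F
  have hG : ∀ v, eval v G = eval (Sum.elim P.rep v) F := by
    intro v
    have := eval_aeval_mv (Sum.elim (fun j => C (P.rep j)) X) v F
    rw [this]
    congr 2
    ext (i | i) <;> simp
  have hd : G.totalDegree ≤ d.2 := by
    simp only [G]
    conv_lhs => rw [F.as_sum, map_sum]
    refine totalDegree_finsetSum_le fun m hm => ?_
    rw [aeval_monomial, Finsupp.prod_fintype _ _ (by simp)]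
    simp only [Fintype.prod_sum_type, Sum.elim_inl, Sum.elim_inr, algebraMap_eq, ← C_pow, ← map_prod]
    rw [← mul_assoc, ← C_mul]
    rw [← (hF m hm).2]
    refine (totalDegree_mul _ _).trans ?_
    refine (Nat.add_le_add le_rfl (totalDegree_finsetProd _ _)).trans ?_
    rw [totalDegree_C, zero_add]
    exact Finset.sum_le_sum fun i _ => (totalDegree_X_pow _ _).le
  rw [← hG]
  refine binary_bound G d.2 hd S ?_ hS Q
  intro s hs c hc
  rw [hG]
  exact h s hs _ _ P.rep_nonzero (smul_ne_zero hc s.rep_nonzero)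
    (Projectivization.mk_rep _) ((rep_mk _ _ _).2 ⟨c, hc, rfl⟩)

open Classical in
/-- fibres -/
noncomputable def fY (Y : Finset (Proj1 k × Proj1 k)) (P : Proj1 k) : Finset (Proj1 k) :=
  (Y.filter fun T => T.1 = P).image Prod.snd
open Classical in
noncomputable def fX (Y : Finset (Proj1 k × Proj1 k)) (Q : Proj1 k) : Finset (Proj1 k) :=
  (Y.filter fun T => T.2 = Q).image Prod.fst

theorem mem_fY (Y : Finset (Proj1 k × Proj1 k)) (P Q : Proj1 k) : Q ∈ fY Y P ↔ (P, Q) ∈ Y := by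
  simp [fY]
theorem mem_fX (Y : Finset (Proj1 k × Proj1 k)) (P Q : Proj1 k) : P ∈ fX Y Q ↔ (P, Q) ∈ Y := by
  simp [fX]

theorem exists_sep [Infinite k] (Y : Finset (Proj1 k × Proj1 k)) (P Q : Proj1 k)
    (S T : Finset (Proj1 k)) (hS : P ∉ S) (hT : Q ∉ T)
    (h : ∀ P' Q', (P', Q') ∈ Y → (P', Q') ≠ (P, Q) → P' ∈ S ∨ Q' ∈ T) :
    (S.card, T.card) ∈ sepDegrees Y (P, Q) := by
  classical
  refine ⟨(∏ s ∈ S, vX s) * ∏ t ∈ T, vY t, ?_, ?_, ?_⟩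
  · have := bihom_mul (bihom_prod S vX (1, 0) fun s _ => bihom_vX s)
      (bihom_prod T vY (0, 1) fun s _ => bihom_vY s)
    simpa using this
  · rw [vanishes_iff]
    simp only [map_mul, map_prod, phi_vX, phi_vY]
    simp only [mul_eq_zero, Finset.prod_eq_zero_iff, not_or, not_exists, not_and,
      map_eq_zero, dt_eq_zero, X_ne_zero, not_false_eq_true, and_true]
    constructor
    · rintro s hs rfl; exact hS hs
    · rintro s hs rfl; exact hT hs
  · rintro ⟨P', Q'⟩ hm hne
    rw [vanishes_iff]
    simp only [map_mul, map_prod, phi_vX, phi_vY]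
    rcases h P' Q' hm hne with h1 | h1
    · rw [Finset.prod_eq_zero h1, zero_mul]
      simp [(dt_eq_zero P' P').2 rfl]
    · rw [mul_comm, Finset.prod_eq_zero h1, zero_mul]
      simp [(dt_eq_zero Q' Q').2 rfl]

open Classical in
theorem sep1 [Infinite k] (Y : Finset (Proj1 k × Proj1 k)) (P Q : Proj1 k) :
    (((Y.image Prod.fst).erase P).card, ((fY Y P).erase Q).card) ∈ sepDegrees Y (P, Q) := by
  apply exists_sep <;> simp [mem_fY]
  intro P' Q' h h1
  by_cases h2 : P' = P
  · subst h2; right; exact ⟨h1 rfl, h⟩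
  · left; exact ⟨h2, _, h⟩

open Classical in
theorem sep2 [Infinite k] (Y : Finset (Proj1 k × Proj1 k)) (P Q : Proj1 k) :
    (((fX Y Q).erase P).card, ((Y.image Prod.snd).erase Q).card) ∈ sepDegrees Y (P, Q) := by
  apply exists_sep <;> simp [mem_fX]
  intro P' Q' h h1
  by_cases h2 : Q' = Q
  · subst h2; left; exact ⟨fun h3 => h1 h3 rfl, h⟩
  · right; exact ⟨h2, _, h⟩

theorem degSet_least (Y : Finset (Proj1 k × Proj1 k)) (P : Proj1 k × Proj1 k) (d : ℕ × ℕ)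
    (h : degSet Y P = {d}) (e : ℕ × ℕ) (he : e ∈ sepDegrees Y P) : d ≤ e := by
  obtain ⟨m, hm, hmin⟩ := exists_minimal_le_of_wellFoundedLT (· ∈ sepDegrees Y P) e he
  have : m ∈ degSet Y P := ⟨hmin.1, fun x hx hxm => le_antisymm hxm (hmin.2 hx hxm)⟩
  rw [h, Set.mem_singleton_iff] at this
  exact this ▸ hm

def NStar (Y : Finset (Proj1 k × Proj1 k)) : Prop :=
  ∀ P P', fY Y P ⊆ fY Y P' ∨ fY Y P' ⊆ fY Y P

theorem single_star [Infinite k] (Y : Finset (Proj1 k × Proj1 k))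
    (h : ∀ P ∈ Y, ∃ d : ℕ × ℕ, degSet Y P = {d}) : NStar Y := by
  classical
  have key : ∀ P P', (fY Y P).card ≤ (fY Y P').card → fY Y P ⊆ fY Y P' := by
    intro P P' hc Q hQ
    by_contra hQ'
    rw [mem_fY] at hQ hQ'
    have hne : P' ≠ P := by rintro rfl; exact hQ' hQ
    obtain ⟨d, hd⟩ := h _ hQ
    have h1 := (degSet_least _ _ _ hd _ (sep1 Y P Q)).2
    have h2 := (degSet_least _ _ _ hd _ (sep2 Y P Q)).1
    have hdm : d ∈ degSet Y (P, Q) := by rw [hd]; rfl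
    obtain ⟨F, hF, hFP, hFv⟩ := hdm.1
    simp only at h1 h2
    rw [Finset.card_erase_of_mem ((mem_fY _ _ _).2 hQ)] at h1
    rw [Finset.card_erase_of_mem ((mem_fX _ _ _).2 hQ)] at h2
    have p1 := Finset.card_pos.2 ⟨_, (mem_fY _ _ _).2 hQ⟩
    have p2 := Finset.card_pos.2 ⟨_, (mem_fX _ _ _).2 hQ⟩
    have v1 : VanishesAt F (P', Q) := by
      apply ybound hF P' (fY Y P') (by omega)
      intro s hs
      exact hFv _ ((mem_fY _ _ _).1 hs) (by simp [hne])
    apply hFP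
    have hP' : P' ∉ (fX Y Q).erase P := by simp [mem_fX, hQ']
    apply xbound hF Q (insert P' ((fX Y Q).erase P))
    · rw [Finset.card_insert_of_notMem hP', Finset.card_erase_of_mem ((mem_fX _ _ _).2 hQ)]; omega
    · intro s hs
      rcases Finset.mem_insert.1 hs with rfl | hs
      · exact v1
      · rw [Finset.mem_erase, mem_fX] at hs
        exact hFv _ hs.2 (by simp [hs.1])
  intro P P'
  rcases le_total (fY Y P).card (fY Y P').card with h | h
  · exact Or.inl (key _ _ h)
  · exact Or.inr (key _ _ h)

theorem sep_of_coeff [Infinite k] [DecidableEq (Proj1 k × Proj1 k)]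
    (Y : Finset (Proj1 k × Proj1 k)) (T : Proj1 k × Proj1 k)
    (g : BiPoly k) (hg : g ∈ vanishingIdeal (Y.erase T)) (d : ℕ × ℕ)
    (h : coeff (ex d) (phi T g) ≠ 0) : d ∈ sepDegrees Y T := by
  obtain ⟨G, hG, hG'⟩ := component g d
  refine ⟨G, hG, ?_, ?_⟩
  · rw [vanishes_iff, hG']
    simpa using h
  · intro Q hQ hne
    rw [vanishes_iff, hG', (mem_vI _ _).1 hg Q (Finset.mem_erase.2 ⟨hne, hQ⟩)]
    simp

open Classical in
theorem sep_lower [Infinite k] (Y : Finset (Proj1 k × Proj1 k)) (P Q : Proj1 k)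
    (d : ℕ × ℕ) (hd : d ∈ sepDegrees Y (P, Q)) :
    ((fX Y Q).erase P).card ≤ d.1 ∧ ((fY Y P).erase Q).card ≤ d.2 := by
  obtain ⟨F, hF, h1, h2⟩ := hd
  constructor
  · by_contra hlt
    refine h1 (xbound hF Q _ (not_le.1 hlt) ?_ P)
    intro s hs
    rw [Finset.mem_erase, mem_fX] at hs
    exact h2 _ hs.2 (by simp [hs.1])
  · by_contra hlt
    refine h1 (ybound hF P _ (not_le.1 hlt) ?_ Q)
    intro s hs
    rw [Finset.mem_erase, mem_fY] at hs
    exact h2 _ hs.2 (by simp [hs.1])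

theorem phi_surj (T : Proj1 k × Proj1 k) (P0 Q0 : Proj1 k) (hP : P0 ≠ T.1) (hQ : Q0 ≠ T.2)
    (w : MvPolynomial (Fin 2) k) : ∃ W, phi T W = w := by
  have hP' := fun h => hP ((dt_eq_zero _ _).1 h)
  have hQ' := fun h => hQ ((dt_eq_zero _ _).1 h)
  induction w using MvPolynomial.induction_on with
  | C a => exact ⟨C a, by simp [phi, algebraMap_eq]⟩
  | add p q hp hq =>
    obtain ⟨p', rfl⟩ := hp
    obtain ⟨q', rfl⟩ := hq
    exact ⟨p' + q', map_add _ _ _⟩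
  | mul_X p i hp =>
    obtain ⟨p', rfl⟩ := hp
    have hC : ∀ c, phi T (C c) = C c := fun c => by simp [phi, algebraMap_eq]
    have : ∃ Z, phi T Z = X i := by
      fin_cases i
      · refine ⟨C (dt P0 T.1)⁻¹ * vX P0, ?_⟩
        rw [map_mul, phi_vX, hC, ← mul_assoc, ← C_mul, inv_mul_cancel₀ hP']; simp
      · refine ⟨C (dt Q0 T.2)⁻¹ * vY Q0, ?_⟩
        rw [map_mul, phi_vY, hC, ← mul_assoc, ← C_mul, inv_mul_cancel₀ hQ']; simp
    obtain ⟨Z, hZ⟩ := this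
    exact ⟨p' * Z, by rw [map_mul, hZ]⟩

theorem dvd_aux (a b : ℕ) (μ ν : k) (hν : ν ≠ 0) (f g : MvPolynomial (Fin 2) k)
    (hf : ∀ d, coeff (ex d) f ≠ 0 → a ≤ d.1 ∧ b ≤ d.2)
    (hg : ∀ d, coeff (ex d) g ≠ 0 → a ≤ d.1 ∧ b ≤ d.2)
    (h : C ν * X 1 * g = C μ * X 0 * f) : monomial (ex (a + 1, b)) 1 ∣ g := by
  rw [monomial_one_dvd_iff_modMonomial_eq_zero]
  ext m
  by_cases hm : ex (a + 1, b) ≤ m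
  · rw [coeff_modMonomial_of_le _ hm]; simp
  rw [coeff_modMonomial_of_not_le _ hm, coeff_zero]
  by_contra hne
  rw [ex_surj m] at hne hm
  generalize m 0 = i at *
  generalize m 1 = j at *
  obtain ⟨h1, h2⟩ := hg _ hne
  simp only at h1 h2
  have hi : i = a := by
    by_contra hia
    apply hm
    intro t
    fin_cases t <;> simp [ex] <;> omega
  have h3 := congrArg (coeff (Finsupp.single 1 1 + ex (i, j))) h
  rw [mul_assoc, mul_assoc, coeff_C_mul, coeff_C_mul, coeff_X_mul] at h3
  rcases Nat.eq_zero_or_pos i with hi0 | hi0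
  · rw [coeff_X_mul', if_neg (by simp [ex, hi0]), mul_zero] at h3
    exact (mul_ne_zero hν hne) h3
  · obtain ⟨i', rfl⟩ : ∃ i', i = i' + 1 := ⟨i - 1, by omega⟩
    have e : Finsupp.single 1 1 + ex (i' + 1, j) = Finsupp.single 0 1 + ex (i', j + 1) := by
      ext t
      fin_cases t <;> simp [ex] <;> omega
    rw [e, coeff_X_mul] at h3
    have h4 : coeff (ex (i', j + 1)) f ≠ 0 := by
      intro h4
      rw [h4, mul_zero] at h3
      exact (mul_ne_zero hν hne) h3
    have := (hf _ h4).1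
    simp only at this
    omega

theorem star_regular [Infinite k] (n : ℕ) : ∀ Y : Finset (Proj1 k × Proj1 k), Y.card = n →
    NStar Y → ∀ P0 Q0 : Proj1 k, (∀ T ∈ Y, P0 ≠ T.1) → (∀ T ∈ Y, Q0 ≠ T.2) → ∀ f g : BiPoly k,
    vY Q0 * g - vX P0 * f ∈ vanishingIdeal Y → ∃ e, g - vX P0 * e ∈ vanishingIdeal Y := by
  classical
  induction n with
  | zero =>
    intro Y hY _ P0 Q0 _ _ f g _
    rw [Finset.card_eq_zero] at hY
    subst hY
    exact ⟨0, by rw [mem_vI]; simp⟩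
  | succ n ih =>
    intro Y hY hst P0 Q0 hP0 hQ0 f g hfg
    have hne : Y.Nonempty := Finset.card_pos.1 (by omega)
    obtain ⟨⟨P, Q⟩, hT, hmin⟩ := Finset.exists_min_image Y (fun T => (fY Y T.1).card) hne
    have hsub : ∀ T ∈ Y, fY Y P ⊆ fY Y T.1 := by
      intro T hT'
      rcases hst P T.1 with h | h
      · exact h
      · exact (Finset.eq_of_subset_of_card_le h (hmin T hT')).symm.subset
    set Y' := Y.erase (P, Q) with hY'
    have hfY : ∀ R S, S ∈ fY Y' R ↔ (R, S) ≠ (P, Q) ∧ S ∈ fY Y R := by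
      intro R S; rw [mem_fY, mem_fY, hY', Finset.mem_erase]
    have hst' : NStar Y' := by
      have hempty : ∀ R, fY Y R ⊆ fY Y P ∨ fY Y P ⊆ fY Y R := fun R => hst R P
      have hP : ∀ R, fY Y' R = ∅ ∨ fY Y' P ⊆ fY Y' R := by
        intro R
        by_cases hRP : R = P
        · right; rw [hRP]
        rcases Finset.eq_empty_or_nonempty (fY Y' R) with h | ⟨S, hS⟩
        · exact Or.inl h
        right
        intro U hU
        rw [hfY] at hU hS ⊢
        refine ⟨by simp [hRP], hsub (R, S) ((mem_fY _ _ _).1 hS.2) hU.2⟩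
      intro R R'
      by_cases hR : R = P
      · subst hR
        rcases hP R' with h | h
        · right; rw [h]; simp
        · exact Or.inl h
      by_cases hR' : R' = P
      · subst hR'
        rcases hP R with h | h
        · left; rw [h]; simp
        · exact Or.inr h
      rcases hst R R' with h | h
      · left; intro S hS; rw [hfY] at hS ⊢; exact ⟨by simp [hR'], h hS.2⟩
      · right; intro S hS; rw [hfY] at hS ⊢; exact ⟨by simp [hR], h hS.2⟩
    have hsubY : ∀ T ∈ Y', T ∈ Y := fun T hT => Finset.mem_of_mem_erase hT
    have hfg' := (mem_vI _ _).1 hfg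
    obtain ⟨e, he⟩ := ih Y' (by rw [hY', Finset.card_erase_of_mem hT]; omega) hst' P0 Q0
      (fun T h => hP0 T (hsubY T h)) (fun T h => hQ0 T (hsubY T h)) f g
      ((mem_vI _ _).2 fun T h => hfg' T (hsubY T h))
    set g' := g - vX P0 * e with hg'
    set f' := f - vY Q0 * e with hf'
    have hrel : ∀ T ∈ Y, C (dt Q0 T.2) * X 1 * phi T g' = C (dt P0 T.1) * X 0 * phi T f' := by
      intro T hT
      have := hfg' T hT
      rw [map_sub, map_mul, map_mul, phi_vX, phi_vY] at this
      rw [hg', hf', map_sub, map_sub, map_mul, map_mul, phi_vX, phi_vY]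
      linear_combination this
    have hdP : ∀ T ∈ Y, dt P0 T.1 ≠ 0 := fun T hT h => hP0 T hT ((dt_eq_zero _ _).1 h)
    have hdQ : ∀ T ∈ Y, dt Q0 T.2 ≠ 0 := fun T hT h => hQ0 T hT ((dt_eq_zero _ _).1 h)
    have hf'I : f' ∈ vanishingIdeal Y' := by
      rw [mem_vI]
      intro T hT
      have h1 := hrel T (hsubY T hT)
      rw [(mem_vI _ _).1 he T hT, mul_zero] at h1
      have h2 := hdP T (hsubY T hT)
      simpa [h2] using h1.symm
    have himg : (Y.image Prod.fst) = fX Y Q := by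
      ext R
      rw [mem_fX, Finset.mem_image]
      constructor
      · rintro ⟨T, hT', rfl⟩
        exact (mem_fY _ _ _).1 (hsub T hT' ((mem_fY _ _ _).2 hT))
      · intro h; exact ⟨_, h, rfl⟩
    have hsep := sep1 Y P Q
    rw [himg] at hsep
    set a := ((fX Y Q).erase P).card with ha
    set b := ((fY Y P).erase Q).card with hb
    have hrelPQ : C (dt Q0 Q) * X 1 * phi (P, Q) g' = C (dt P0 P) * X 0 * phi (P, Q) f' :=
      hrel (P, Q) hT
    obtain ⟨w, hw⟩ := dvd_aux a b (dt P0 P) (dt Q0 Q) (hdQ _ hT) (phi (P, Q) f') (phi (P, Q) g')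
      (fun d hd => sep_lower Y P Q d (sep_of_coeff Y (P, Q) f' hf'I d hd))
      (fun d hd => sep_lower Y P Q d (sep_of_coeff Y (P, Q) g' he d hd))
      hrelPQ
    obtain ⟨S, hS, hSP, hSv⟩ := hsep
    obtain ⟨c, hc⟩ := bihom_phi hS (P, Q)
    rw [vanishes_iff, hc] at hSP
    have hc0 : c ≠ 0 := by rintro rfl; simp at hSP
    obtain ⟨W, hW⟩ := phi_surj (P, Q) P0 Q0 (hP0 _ hT) (hQ0 _ hT) w
    refine ⟨e + C ((dt P0 P)⁻¹ * c⁻¹) * S * W, ?_⟩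
    have hre : g - vX P0 * (e + C ((dt P0 P)⁻¹ * c⁻¹) * S * W) =
        g' - vX P0 * (C ((dt P0 P)⁻¹ * c⁻¹) * S * W) := by rw [hg']; ring
    rw [hre, mem_vI]
    have hC : ∀ T c, phi T (C c : BiPoly k) = C c := fun T c => by simp [phi, algebraMap_eq]
    intro T hTY
    by_cases hTe : T = (P, Q)
    · subst hTe
      rw [map_sub, map_mul, map_mul, map_mul, hC, hc, hW, phi_vX, hw]
      have e1 : (monomial (ex (a + 1, b)) 1 : MvPolynomial (Fin 2) k) = X 0 * monomial (ex (a, b)) 1 := by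
        have e0 : ex (a + 1, b) = Finsupp.single 0 1 + ex (a, b) := by
          ext t; fin_cases t <;> simp [ex]; omega
        rw [X, monomial_mul, one_mul, e0]
      have e2 : (monomial (ex (a, b)) c : MvPolynomial (Fin 2) k) = C c * monomial (ex (a, b)) 1 := by
        rw [C_mul_monomial, mul_one]
      rw [e1, e2]
      have e3 : (C (dt P0 P) * C ((dt P0 P)⁻¹ * c⁻¹) * C c : MvPolynomial (Fin 2) k) = 1 := by
        rw [← C_mul, ← C_mul, ← C_1]
        congr 1
        have := hdP _ hT
        simp only at this
        field_simp
      linear_combination (-(X 0 * monomial (ex (a, b)) 1 * w)) * e3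
    · have h1 := (mem_vI _ _).1 he T (Finset.mem_erase.2 ⟨hTe, hTY⟩)
      have h2 := (vanishes_iff _ _).1 (hSv T hTY hTe)
      rw [map_sub, h1, map_mul, map_mul, map_mul, h2]
      simp

theorem phi_C (T : Proj1 k × Proj1 k) (c : k) : phi T (C c : BiPoly k) = C c := by
  simp [phi, algebraMap_eq]

theorem vX_mem (P : Proj1 k) :
    vX P ∈ Ideal.span (Set.range (X : (Fin 2 ⊕ Fin 2) → BiPoly k)) := by
  rw [vX]
  exact Ideal.sub_mem _ (Ideal.mul_mem_left _ _ (Ideal.subset_span ⟨_, rfl⟩))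
    (Ideal.mul_mem_left _ _ (Ideal.subset_span ⟨_, rfl⟩))

theorem vY_mem (P : Proj1 k) :
    vY P ∈ Ideal.span (Set.range (X : (Fin 2 ⊕ Fin 2) → BiPoly k)) := by
  rw [vY]
  exact Ideal.sub_mem _ (Ideal.mul_mem_left _ _ (Ideal.subset_span ⟨_, rfl⟩))
    (Ideal.mul_mem_left _ _ (Ideal.subset_span ⟨_, rfl⟩))

theorem span_const (F : BiPoly k)
    (hF : F ∈ Ideal.span (Set.range (X : (Fin 2 ⊕ Fin 2) → BiPoly k))) : constantCoeff F = 0 := by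
  have : Ideal.span (Set.range (X : (Fin 2 ⊕ Fin 2) → BiPoly k)) ≤
      RingHom.ker (constantCoeff : BiPoly k →+* k) := by
    rw [Ideal.span_le]
    rintro _ ⟨i, rfl⟩
    simp [RingHom.mem_ker]
  exact this hF

theorem vI_const [Infinite k] (Y : Finset (Proj1 k × Proj1 k)) (hY : Y.Nonempty) (F : BiPoly k)
    (hF : F ∈ vanishingIdeal Y) : constantCoeff F = 0 := by
  obtain ⟨T, hT⟩ := hY
  have h := eval_phi T F 0
  rw [(mem_vI _ _).1 hF T hT] at h
  have e : (Sum.elim ((0 : Fin 2 → k) 0 • T.1.rep) ((0 : Fin 2 → k) 1 • T.2.rep)) = 0 := by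
    ext (i | i) <;> simp
  rw [e, map_zero] at h
  rw [← eval_zero']
  exact h.symm

theorem not_one_mem [Infinite k] (Y : Finset (Proj1 k × Proj1 k)) (hY : Y.Nonempty) :
    (1 : BiPoly k ⧸ vanishingIdeal Y) ∉ irrelevantIdeal Y := by
  intro h
  let f : (BiPoly k ⧸ vanishingIdeal Y) →+* k :=
    Ideal.Quotient.lift _ constantCoeff (vI_const Y hY)
  have : irrelevantIdeal Y ≤ RingHom.ker f := by
    rw [irrelevantIdeal, Ideal.map_le_iff_le_comap]
    intro F hF
    rw [Ideal.mem_comap, RingHom.mem_ker]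
    simpa [f] using span_const F hF
  have h1 := this h
  rw [RingHom.mem_ker, map_one] at h1
  exact one_ne_zero h1

theorem nzd [Infinite k] (Y : Finset (Proj1 k × Proj1 k)) (F : BiPoly k)
    (hF : ∀ T ∈ Y, phi T F ≠ 0) (z : BiPoly k ⧸ vanishingIdeal Y)
    (hz : Ideal.Quotient.mk _ F * z = 0) : z = 0 := by
  obtain ⟨G, rfl⟩ := Ideal.Quotient.mk_surjective z
  rw [← map_mul, Ideal.Quotient.eq_zero_iff_mem, mem_vI] at hz
  rw [Ideal.Quotient.eq_zero_iff_mem, mem_vI]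
  intro T hT
  have := hz T hT
  rw [map_mul] at this
  exact (mul_eq_zero.1 this).resolve_left (hF T hT)

theorem dim_le [Infinite k] (Y : Finset (Proj1 k × Proj1 k)) (P0 Q0 : Proj1 k)
    (hP0 : ∀ T ∈ Y, P0 ≠ T.1) (hQ0 : ∀ T ∈ Y, Q0 ≠ T.2) :
    ringKrullDim (BiPoly k ⧸ vanishingIdeal Y) ≤ 2 := by
  have hdP : ∀ T ∈ Y, dt P0 T.1 ≠ 0 := fun T hT h => hP0 T hT ((dt_eq_zero _ _).1 h)
  have hdQ : ∀ T ∈ Y, dt Q0 T.2 ≠ 0 := fun T hT h => hQ0 T hT ((dt_eq_zero _ _).1 h)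
  let g : MvPolynomial (Fin 2) k →ₐ[k] BiPoly k := aeval ![vX P0, vY Q0]
  let f : MvPolynomial (Fin 2) k →+* BiPoly k ⧸ vanishingIdeal Y :=
    (Ideal.Quotient.mk _).comp (g : MvPolynomial (Fin 2) k →+* BiPoly k)
  have hint : ∀ (v : BiPoly k) (c : Proj1 k × Proj1 k → MvPolynomial (Fin 2) k),
      (∀ T ∈ Y, phi T (v - g (c T)) = 0) → f.IsIntegralElem (Ideal.Quotient.mk _ v) := by
    intro v c hc
    refine ⟨∏ T ∈ Y, (Polynomial.X - Polynomial.C (c T)),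
      Polynomial.monic_prod_of_monic _ _ fun T _ => Polynomial.monic_X_sub_C _, ?_⟩
    rw [Polynomial.eval₂_finsetProd]
    have : ∀ T ∈ Y, Polynomial.eval₂ f (Ideal.Quotient.mk (vanishingIdeal Y) v)
        (Polynomial.X - Polynomial.C (c T)) = Ideal.Quotient.mk _ (v - g (c T)) := by
      intro T _
      simp [f]
    rw [Finset.prod_congr rfl this, ← map_prod, Ideal.Quotient.eq_zero_iff_mem, mem_vI]
    intro T hT
    rw [map_prod]
    exact Finset.prod_eq_zero hT (hc T hT)
  have hf : f.IsIntegral := by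
    intro z
    obtain ⟨F, rfl⟩ := Ideal.Quotient.mk_surjective z
    induction F using MvPolynomial.induction_on with
    | C c =>
      have : Ideal.Quotient.mk (vanishingIdeal Y) (C c) = f (C c) := by simp [f, g, algebraMap_eq]
      rw [this]
      exact RingHom.isIntegralElem_map f
    | add p q hp hq => rw [map_add]; exact RingHom.IsIntegralElem.add f hp hq
    | mul_X p s hp =>
      rw [map_mul]
      refine RingHom.IsIntegralElem.mul f hp ?_
      rcases s with i | i
      · refine hint _ (fun T => C (T.1.rep i / dt P0 T.1) * X 0) ?_
        intro T hT
        have := hdP T hT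
        simp only [g, map_sub, map_mul, algHom_C, algebraMap_eq, aeval_X,
          Matrix.cons_val_zero, phi_vX]
        rw [← mul_assoc, ← C_mul, div_mul_cancel₀ _ this]
        simp [phi]
      · refine hint _ (fun T => C (T.2.rep i / dt Q0 T.2) * X 1) ?_
        intro T hT
        have := hdQ T hT
        simp only [g, map_sub, map_mul, algHom_C, algebraMap_eq, aeval_X,
          Matrix.cons_val_one, Matrix.cons_val_zero, phi_vY]
        rw [← mul_assoc, ← C_mul, div_mul_cancel₀ _ this]
        simp [phi]
  refine (krull_integral f hf).trans ?_
  rw [MvPolynomial.ringKrullDim_of_isNoetherianRing]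
  simp

theorem exists_P0 [Infinite k] (Y : Finset (Proj1 k × Proj1 k)) :
    ∃ P0 : Proj1 k, ∀ T ∈ Y, P0 ≠ T.1 := by
  classical
  obtain ⟨P, hP⟩ := exists_notMem_proj (Y.image Prod.fst)
  exact ⟨P, fun T hT h => hP (Finset.mem_image.2 ⟨T, hT, h.symm⟩)⟩

theorem exists_Q0 [Infinite k] (Y : Finset (Proj1 k × Proj1 k)) :
    ∃ Q0 : Proj1 k, ∀ T ∈ Y, Q0 ≠ T.2 := by
  classical
  obtain ⟨P, hP⟩ := exists_notMem_proj (Y.image Prod.snd)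
  exact ⟨P, fun T hT h => hP (Finset.mem_image.2 ⟨T, hT, h.symm⟩)⟩

theorem phi_vX_ne (P0 : Proj1 k) (T : Proj1 k × Proj1 k) (h : P0 ≠ T.1) : phi T (vX P0) ≠ 0 := by
  rw [phi_vX]
  exact mul_ne_zero (fun h' => h ((dt_eq_zero _ _).1 (C_eq_zero.1 h'))) (X_ne_zero _)

theorem star_acm [Infinite k] (Y : Finset (Proj1 k × Proj1 k)) (hY : Y.Nonempty) (h : NStar Y) :
    IsACM Y := by
  obtain ⟨P0, hP0⟩ := exists_P0 Y
  obtain ⟨Q0, hQ0⟩ := exists_Q0 Y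
  have hub : ∀ n ∈ {n | ∃ rs : List (BiPoly k ⧸ vanishingIdeal Y), rs.length = n ∧
      (∀ r ∈ rs, r ∈ irrelevantIdeal Y) ∧
      RingTheory.Sequence.IsRegular (BiPoly k ⧸ vanishingIdeal Y) rs}, n ≤ 2 := by
    rintro n ⟨rs, rfl, _, hrs⟩
    have h1 := krull_bound (BiPoly k ⧸ vanishingIdeal Y) rs hrs
    rw [Module.supportDim_self_eq_ringKrullDim] at h1
    have h2 := h1.trans (dim_le Y P0 Q0 hP0 hQ0)
    exact_mod_cast h2
  have hmX : Ideal.Quotient.mk (vanishingIdeal Y) (vX P0) ∈ irrelevantIdeal Y :=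
    Ideal.mem_map_of_mem _ (vX_mem P0)
  have hmY : Ideal.Quotient.mk (vanishingIdeal Y) (vY Q0) ∈ irrelevantIdeal Y :=
    Ideal.mem_map_of_mem _ (vY_mem Q0)
  have hmem : 2 ∈ {n | ∃ rs : List (BiPoly k ⧸ vanishingIdeal Y), rs.length = n ∧
      (∀ r ∈ rs, r ∈ irrelevantIdeal Y) ∧
      RingTheory.Sequence.IsRegular (BiPoly k ⧸ vanishingIdeal Y) rs} := by
    refine ⟨[Ideal.Quotient.mk _ (vX P0), Ideal.Quotient.mk _ (vY Q0)], rfl, ?_, ?_⟩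
    · intro r hr
      simp only [List.mem_cons, List.not_mem_nil, or_false] at hr
      rcases hr with rfl | rfl
      · exact hmX
      · exact hmY
    · refine ⟨?_, ?_⟩
      · rw [regular_pair_iff]
        refine ⟨nzd Y _ fun T hT => phi_vX_ne _ _ (hP0 T hT), ?_⟩
        intro z w hzw
        obtain ⟨g, rfl⟩ := Ideal.Quotient.mk_surjective z
        obtain ⟨f, rfl⟩ := Ideal.Quotient.mk_surjective w
        rw [← map_mul, ← map_mul, Ideal.Quotient.eq] at hzw
        obtain ⟨e, he⟩ := star_regular _ Y rfl h P0 Q0 hP0 hQ0 f g hzw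
        refine ⟨Ideal.Quotient.mk _ e, ?_⟩
        rw [← map_mul, Ideal.Quotient.eq]
        exact he
      · intro htop
        apply not_one_mem Y hY
        have hle : Ideal.ofList [Ideal.Quotient.mk (vanishingIdeal Y) (vX P0),
            Ideal.Quotient.mk (vanishingIdeal Y) (vY Q0)] ≤ irrelevantIdeal Y := by
          rw [Ideal.ofList, Ideal.span_le]
          intro r hr
          simp only [List.mem_cons, List.not_mem_nil, or_false, Set.mem_ofPred_eq] at hr
          rcases hr with rfl | rfl
          · exact hmX
          · exact hmY
        apply hle
        have h1 : (1 : BiPoly k ⧸ vanishingIdeal Y) ∈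
          (⊤ : Submodule (BiPoly k ⧸ vanishingIdeal Y) (BiPoly k ⧸ vanishingIdeal Y)) := trivial
        rw [htop] at h1
        simpa using h1
  unfold IsACM depthWrt
  exact le_antisymm (csSup_le ⟨2, hmem⟩ hub) (le_csSup ⟨2, hub⟩ hmem)

theorem sSup_two (S : Set ℕ) (h : sSup S = 2) : 2 ∈ S := by
  rw [← h]
  apply Nat.sSup_mem
  · by_contra hne
    rw [Set.not_nonempty_iff_eq_empty] at hne
    rw [hne] at h
    simp at h
  · by_contra hne
    rw [Nat.sSup_of_not_bddAbove hne] at h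
    omega

theorem mono_ex (u v : ℕ) (c : k) :
    (monomial (ex (u, v)) c : MvPolynomial (Fin 2) k) = C c * X 0 ^ u * X 1 ^ v := by
  rw [X_pow_eq_monomial, X_pow_eq_monomial, mul_assoc, monomial_mul, C_mul_monomial, ex]
  simp

theorem acm_inf [Infinite k] (Y : Finset (Proj1 k × Proj1 k)) (hA : IsACM Y)
    (T : Proj1 k × Proj1 k) (hT : T ∈ Y) (a b i j : ℕ)
    (hd : (a, b + j) ∈ sepDegrees Y T) (he : (a + i, b) ∈ sepDegrees Y T) :
    (a, b) ∈ sepDegrees Y T := by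
  classical
  obtain ⟨P0, hP0⟩ := exists_P0 Y
  obtain ⟨Q0, hQ0⟩ := exists_Q0 Y
  have hp : dt P0 T.1 ≠ 0 := fun h => hP0 T hT ((dt_eq_zero _ _).1 h)
  have hq : dt Q0 T.2 ≠ 0 := fun h => hQ0 T hT ((dt_eq_zero _ _).1 h)
  -- a regular sequence of length two
  have hreg : 2 ∈ {n | ∃ rs : List (BiPoly k ⧸ vanishingIdeal Y), rs.length = n ∧
      (∀ r ∈ rs, r ∈ irrelevantIdeal Y) ∧
      RingTheory.Sequence.IsRegular (BiPoly k ⧸ vanishingIdeal Y) rs} := by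
    unfold IsACM depthWrt at hA
    exact sSup_two _ hA
  obtain ⟨rs, hlen, hmem, hrs⟩ := hreg
  obtain ⟨r1, r2, rfl⟩ := List.length_eq_two.1 hlen
  obtain ⟨F, hF, hFT, hFv⟩ := hd
  obtain ⟨G, hG, hGT, hGv⟩ := he
  obtain ⟨δ, hδ⟩ := bihom_phi hF T
  obtain ⟨γ, hγ⟩ := bihom_phi hG T
  rw [vanishes_iff, hδ] at hFT
  rw [vanishes_iff, hγ] at hGT
  have hδ0 : δ ≠ 0 := by rintro rfl; simp at hFT
  have hγ0 : γ ≠ 0 := by rintro rfl; simp at hGT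
  rw [mono_ex] at hδ hγ
  have hF0 : ∀ U ∈ Y, U ≠ T → phi U F = 0 := fun U h h' => (vanishes_iff _ _).1 (hFv U h h')
  have hG0 : ∀ U ∈ Y, U ≠ T → phi U G = 0 := fun U h h' => (vanishes_iff _ _).1 (hGv U h h')
  let J : Ideal (BiPoly k ⧸ vanishingIdeal Y) :=
    Submodule.comap (LinearMap.mulRight (BiPoly k ⧸ vanishingIdeal Y)
      (Ideal.Quotient.mk (vanishingIdeal Y) G))
      (Ideal.span {Ideal.Quotient.mk (vanishingIdeal Y) (vX P0 ^ i)})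
  have hJ : ∀ r, r ∈ J ↔ Ideal.Quotient.mk (vanishingIdeal Y) (vX P0 ^ i) ∣
      r * Ideal.Quotient.mk (vanishingIdeal Y) G := by
    intro r
    rw [← Ideal.mem_span_singleton]
    rfl
  have hJker : ∀ v, phi T v = 0 → Ideal.Quotient.mk (vanishingIdeal Y) v ∈ J := by
    intro v hv
    rw [hJ, ← map_mul]
    have : Ideal.Quotient.mk (vanishingIdeal Y) (v * G) = 0 := by
      rw [Ideal.Quotient.eq_zero_iff_mem, mem_vI]
      intro U hU
      by_cases hUT : U = T
      · rw [hUT, map_mul, hv, zero_mul]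
      · rw [map_mul, hG0 U hU hUT, mul_zero]
    rw [this]
    exact dvd_zero _
  have hJX : Ideal.Quotient.mk (vanishingIdeal Y) (vX P0) ∈ J.radical := by
    refine ⟨i, ?_⟩
    rw [← map_pow, hJ]
    exact dvd_mul_right _ _
  have hJY : Ideal.Quotient.mk (vanishingIdeal Y) (vY Q0) ∈ J.radical := by
    refine ⟨j, ?_⟩
    rw [← map_pow, hJ, ← map_mul]
    refine ⟨Ideal.Quotient.mk _ (C (γ * dt Q0 T.2 ^ j * (δ * dt P0 T.1 ^ i)⁻¹) * F), ?_⟩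
    rw [← map_mul, Ideal.Quotient.eq, mem_vI]
    intro U hU
    by_cases hUT : U = T
    · rw [hUT, map_sub, map_mul, map_mul, map_mul, map_pow, map_pow, phi_vX, phi_vY, phi_C, hδ, hγ]
      have e3 : (C (γ * dt Q0 T.2 ^ j * (δ * dt P0 T.1 ^ i)⁻¹) * C δ * C (dt P0 T.1) ^ i
          : MvPolynomial (Fin 2) k) = C γ * C (dt Q0 T.2) ^ j := by
        rw [← C_pow, ← C_pow, ← C_mul, ← C_mul, ← C_mul]
        congr 1
        field_simp
      linear_combination (-(X 0 ^ i * X 0 ^ a * X 1 ^ b * X 1 ^ j)) * e3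
    · rw [map_sub, map_mul, map_mul, map_mul, hF0 U hU hUT, hG0 U hU hUT]
      simp
  have hmJ : irrelevantIdeal Y ≤ J.radical := by
    rw [irrelevantIdeal, Ideal.map_le_iff_le_comap, Ideal.span_le]
    rintro _ ⟨s, rfl⟩
    change Ideal.Quotient.mk (vanishingIdeal Y) (X s) ∈ J.radical
    rcases s with t | t
    · have h1 : phi T (X (Sum.inl t) - C (T.1.rep t / dt P0 T.1) * vX P0) = 0 := by
        rw [map_sub, map_mul, phi_C, phi_vX, ← mul_assoc, ← C_mul, div_mul_cancel₀ _ hp]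
        simp [phi]
      have h2 := Ideal.add_mem _ (Ideal.le_radical (hJker _ h1))
        (Ideal.mul_mem_left _ (Ideal.Quotient.mk _ (C (T.1.rep t / dt P0 T.1))) hJX)
      rwa [← map_mul, ← map_add, sub_add_cancel] at h2
    · have h1 : phi T (X (Sum.inr t) - C (T.2.rep t / dt Q0 T.2) * vY Q0) = 0 := by
        rw [map_sub, map_mul, phi_C, phi_vY, ← mul_assoc, ← C_mul, div_mul_cancel₀ _ hq]
        simp [phi]
      have h2 := Ideal.add_mem _ (Ideal.le_radical (hJker _ h1))
        (Ideal.mul_mem_left _ (Ideal.Quotient.mk _ (C (T.2.rep t / dt Q0 T.2))) hJY)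
      rwa [← map_mul, ← map_add, sub_add_cancel] at h2
  have hdvd := depth_colon (irrelevantIdeal Y) (IsNoetherian.noetherian _) r1 r2
    (Ideal.Quotient.mk _ (vX P0 ^ i)) (Ideal.Quotient.mk _ G)
    (hmem _ (by simp)) (hmem _ (by simp)) hrs.toIsWeaklyRegular
    (nzd Y _ fun U hU => by rw [map_pow]; exact pow_ne_zero _ (phi_vX_ne _ _ (hP0 U hU)))
    J (fun r hr => (hJ r).1 hr) hmJ
  obtain ⟨E, hE⟩ := hdvd
  obtain ⟨E, rfl⟩ := Ideal.Quotient.mk_surjective E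
  rw [← map_mul, Ideal.Quotient.eq, mem_vI] at hE
  have hE' : ∀ U ∈ Y, phi U G = phi U (vX P0) ^ i * phi U E := by
    intro U hU
    have := hE U hU
    rwa [map_sub, map_mul, map_pow, sub_eq_zero] at this
  apply sep_of_coeff Y T E
  · rw [mem_vI]
    intro U hU
    rw [Finset.mem_erase] at hU
    have h1 := hE' U hU.2
    rw [hG0 U hU.2 hU.1] at h1
    exact (mul_eq_zero.1 h1.symm).resolve_left (pow_ne_zero _ (phi_vX_ne _ _ (hP0 U hU.2)))
  · have h1 := hE' T hT
    have h2 : phi T (vX P0) ^ i * phi T E =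
        phi T (vX P0) ^ i * monomial (ex (a, b)) (γ / dt P0 T.1 ^ i) := by
      rw [← h1, hγ, phi_vX, mono_ex]
      have e3 : (C (γ / dt P0 T.1 ^ i) * C (dt P0 T.1) ^ i : MvPolynomial (Fin 2) k) = C γ := by
        rw [← C_pow, ← C_mul, div_mul_cancel₀ _ (pow_ne_zero _ hp)]
      linear_combination (-(X 0 ^ i * X 0 ^ a * X 1 ^ b)) * e3
    have h3 := mul_left_cancel₀ (pow_ne_zero _ (phi_vX_ne _ _ (hP0 T hT))) h2
    rw [h3, coeff_monomial, if_pos rfl]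
    exact div_ne_zero hγ0 (pow_ne_zero _ hp)

theorem acm_single [Infinite k] (Y : Finset (Proj1 k × Proj1 k)) (hA : IsACM Y)
    (T : Proj1 k × Proj1 k) (hT : T ∈ Y) : ∃ d : ℕ × ℕ, degSet Y T = {d} := by
  classical
  have hinf : ∀ d ∈ sepDegrees Y T, ∀ e ∈ sepDegrees Y T,
      (min d.1 e.1, min d.2 e.2) ∈ sepDegrees Y T := by
    have key : ∀ d ∈ sepDegrees Y T, ∀ e ∈ sepDegrees Y T, d.1 ≤ e.1 →
        (min d.1 e.1, min d.2 e.2) ∈ sepDegrees Y T := by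
      rintro ⟨a, b⟩ hd ⟨c, d⟩ he hle
      simp only at hle ⊢
      rw [min_eq_left hle]
      rcases le_total b d with h | h
      · rwa [min_eq_left h]
      · rw [min_eq_right h]
        obtain ⟨i, rfl⟩ := Nat.exists_eq_add_of_le hle
        obtain ⟨j, rfl⟩ := Nat.exists_eq_add_of_le h
        exact acm_inf Y hA T hT a d i j hd he
    intro d hd e he
    rcases le_total d.1 e.1 with h | h
    · exact key d hd e he h
    · rw [min_comm, min_comm d.2]
      exact key e he d hd h
  have hne : (sepDegrees Y T).Nonempty := ⟨_, sep1 Y T.1 T.2⟩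
  obtain ⟨m, hm, hmin⟩ := exists_minimal_le_of_wellFoundedLT (· ∈ sepDegrees Y T) _ hne.some_mem
  have hleast : ∀ e ∈ sepDegrees Y T, m ≤ e := by
    intro e he
    have h1 := hmin.2 (hinf m hmin.1 e he) (show (min m.1 e.1, min m.2 e.2) ≤ m from
      ⟨min_le_left _ _, min_le_left _ _⟩)
    exact ⟨h1.1.trans (min_le_right _ _), h1.2.trans (min_le_right _ _)⟩
  refine ⟨m, ?_⟩
  ext d
  rw [Set.mem_singleton_iff]
  constructor
  · rintro ⟨hd, hd'⟩
    exact (hd' m hmin.1 (hleast d hd)).symm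
  · rintro rfl
    exact ⟨hmin.1, fun e he hle => le_antisymm hle (hleast e he)⟩

end

/-- A finite set of points `X ⊆ ℙ¹×ℙ¹` is ACM (i.e. `depth (R/I_X) = 2`) if and only if
`deg_X(P)` consists of exactly one element for every `P ∈ X`. -/
theorem acm_iff_degree_singleton [IsAlgClosed k] [CharZero k]
    (X : Finset (Proj1 k × Proj1 k)) (hX : X.Nonempty) :
    IsACM X ↔ ∀ P ∈ X, ∃ d : ℕ × ℕ, degSet X P = {d} := by
  have : Infinite k := IsAlgClosed.instInfinite
  exact ⟨fun h P hP => acm_single X h P hP, fun h => star_acm X hX (single_star X h)⟩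
end

section
/- Let X be a finite set of distinct points in ℙ¹×ℙ¹ over k. Then X is arithmetically Cohen–Macaulay (i.e., depth(R/I_X) = 2) if and only if X satisfies property (*). -/
variable {k : Type*} [Field k]

namespace ACMStar

/-- `G` is (the function given by) a binary form of degree `d`. -/
def IsForm : ℕ → ((Fin 2 → k) → k) → Prop
  | 0, G => ∃ c : k, ∀ v, G v = c
  | d + 1, G => ∃ G₁ G₂, IsForm d G₁ ∧ IsForm d G₂ ∧ ∀ v, G v = v 0 * G₁ v + v 1 * G₂ v

theorem IsForm.zero (d : ℕ) : IsForm d (fun _ => (0 : k)) := by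
  induction d with
  | zero => exact ⟨0, fun _ => rfl⟩
  | succ d ih => exact ⟨_, _, ih, ih, fun v => by simp⟩

theorem IsForm.add {d : ℕ} {G H : (Fin 2 → k) → k} (hG : IsForm d G) (hH : IsForm d H) :
    IsForm d (fun v => G v + H v) := by
  induction d generalizing G H with
  | zero =>
    obtain ⟨c, hc⟩ := hG
    obtain ⟨e, he⟩ := hH
    exact ⟨c + e, fun v => by simp [hc, he]⟩
  | succ d ih =>
    obtain ⟨G₁, G₂, h1, h2, h⟩ := hG
    obtain ⟨H₁, H₂, h1', h2', h'⟩ := hH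
    exact ⟨_, _, ih h1 h1', ih h2 h2', fun v => by simp only [h, h']; ring⟩

theorem IsForm.smul {d : ℕ} {G : (Fin 2 → k) → k} (c : k) (hG : IsForm d G) :
    IsForm d (fun v => c * G v) := by
  induction d generalizing G with
  | zero =>
    obtain ⟨e, he⟩ := hG
    exact ⟨c * e, fun v => by simp [he]⟩
  | succ d ih =>
    obtain ⟨G₁, G₂, h1, h2, h⟩ := hG
    exact ⟨_, _, ih h1, ih h2, fun v => by simp only [h]; ring⟩

theorem IsForm.congr {d : ℕ} {G H : (Fin 2 → k) → k} (hG : IsForm d G) (h : ∀ v, H v = G v) :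
    IsForm d H := by
  have : H = G := funext h
  rwa [this]

theorem IsForm.linmul {d : ℕ} {G : (Fin 2 → k) → k} (a b : k) (hG : IsForm d G) :
    IsForm (d + 1) (fun v => (a * v 0 + b * v 1) * G v) :=
  ⟨_, _, hG.smul a, hG.smul b, fun v => by ring⟩

theorem IsForm.coordmul {d : ℕ} {G : (Fin 2 → k) → k} (n : Fin 2) (hG : IsForm d G) :
    IsForm (d + 1) (fun v => v n * G v) := by
  fin_cases n
  · exact (hG.linmul 1 0).congr (fun v => by simp)
  · exact (hG.linmul 0 1).congr (fun v => by simp)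

/-- The linear form vanishing at `P`. -/
noncomputable def ell (P : Proj1 k) (v : Fin 2 → k) : k := P.rep 0 * v 1 - P.rep 1 * v 0

theorem IsForm.ellmul {d : ℕ} {G : (Fin 2 → k) → k} (P : Proj1 k) (hG : IsForm d G) :
    IsForm (d + 1) (fun v => ell P v * G v) :=
  (hG.linmul (-P.rep 1) (P.rep 0)).congr (fun v => by simp only [ell]; ring)

theorem ell_self (P : Proj1 k) : ell P P.rep = 0 := by simp only [ell]; ring

theorem rep_cases (P : Proj1 k) : P.rep 0 ≠ 0 ∨ P.rep 1 ≠ 0 := by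
  by_contra! h
  apply P.rep_nonzero
  ext i
  fin_cases i
  · exact h.1
  · exact h.2

theorem ell_eq_zero {P Q : Proj1 k} (h : ell P Q.rep = 0) : P = Q := by
  have hQ := rep_cases Q
  have hP := rep_cases P
  simp only [ell] at h
  rw [← P.mk_rep, ← Q.mk_rep, Projectivization.mk_eq_mk_iff']
  rcases hQ with hQ | hQ
  · refine ⟨P.rep 0 / Q.rep 0, ?_⟩
    ext i
    fin_cases i
    · simp [hQ]
    · simp only [Pi.smul_apply, smul_eq_mul, Fin.mk_one]
      field_simp
      linear_combination h
  · refine ⟨P.rep 1 / Q.rep 1, ?_⟩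
    ext i
    fin_cases i
    · simp only [Pi.smul_apply, smul_eq_mul, Fin.zero_eta]
      field_simp
      linear_combination -h
    · simp [hQ]

theorem ell_ne_zero {P Q : Proj1 k} (h : P ≠ Q) : ell P Q.rep ≠ 0 :=
  fun hz => h (ell_eq_zero hz)

/-- A linear form not vanishing at `P`. -/
theorem exists_lin (P : Proj1 k) : ∃ a b : k, a * P.rep 0 + b * P.rep 1 = 1 := by
  rcases rep_cases P with h | h
  · exact ⟨(P.rep 0)⁻¹, 0, by simp [h]⟩
  · exact ⟨0, (P.rep 1)⁻¹, by simp [h]⟩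

/-- division with remainder by the linear form of `P`. -/
theorem IsForm.divide {P : Proj1 k} {a b : k} (hab : a * P.rep 0 + b * P.rep 1 = 1) {d : ℕ}
    {G : (Fin 2 → k) → k} (hG : IsForm (d + 1) G) :
    ∃ G', IsForm d G' ∧ ∃ c : k, ∀ v,
      G v = ell P v * G' v + c * (a * v 0 + b * v 1) ^ (d + 1) := by
  -- `v 0 = p0 * λ - b * ell`, `v 1 = p1 * λ + a * ell`
  have e0 : ∀ v : Fin 2 → k, v 0 = P.rep 0 * (a * v 0 + b * v 1) - b * ell P v := by
    intro v
    simp only [ell]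
    linear_combination (-v 0) * hab
  have e1 : ∀ v : Fin 2 → k, v 1 = P.rep 1 * (a * v 0 + b * v 1) + a * ell P v := by
    intro v
    simp only [ell]
    linear_combination (-v 1) * hab
  induction d generalizing G with
  | zero =>
    obtain ⟨G₁, G₂, ⟨c₁, h1⟩, ⟨c₂, h2⟩, h⟩ := hG
    refine ⟨fun _ => -b * c₁ + a * c₂, ⟨_, fun _ => rfl⟩, P.rep 0 * c₁ + P.rep 1 * c₂, ?_⟩
    intro v
    rw [h, h1, h2]
    linear_combination c₁ * e0 v + c₂ * e1 v
  | succ d ih =>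
    obtain ⟨G₁, G₂, h1, h2, h⟩ := hG
    obtain ⟨H₁, hH₁, c₁, h1'⟩ := ih h1
    obtain ⟨H₂, hH₂, c₂, h2'⟩ := ih h2
    refine ⟨_, (((hH₁.linmul a b).smul (P.rep 0)).add ((hH₂.linmul a b).smul (P.rep 1))).add
      ((h1.smul (-b)).add (h2.smul a)), P.rep 0 * c₁ + P.rep 1 * c₂, ?_⟩
    intro v
    rw [h]
    linear_combination G₁ v * e0 v + G₂ v * e1 v + P.rep 0 * (a * v 0 + b * v 1) * h1' v
      + P.rep 1 * (a * v 0 + b * v 1) * h2' v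

theorem IsForm.factor {P : Proj1 k} {d : ℕ} {G : (Fin 2 → k) → k} (hG : IsForm (d + 1) G)
    (h0 : G P.rep = 0) : ∃ G', IsForm d G' ∧ ∀ v, G v = ell P v * G' v := by
  obtain ⟨a, b, hab⟩ := exists_lin P
  obtain ⟨G', hG', c, h⟩ := hG.divide hab
  refine ⟨G', hG', fun v => ?_⟩
  have := h P.rep
  rw [h0, ell_self, hab] at this
  have hc : c = 0 := by simpa using this.symm
  rw [h v, hc]; ring

/-- A binary form of degree `d` with more than `d` zeros vanishes identically. -/
theorem IsForm.eq_zero {d : ℕ} {G : (Fin 2 → k) → k} (hG : IsForm d G) (S : Finset (Proj1 k))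
    (hS : d < S.card) (h0 : ∀ P ∈ S, G P.rep = 0) (v : Fin 2 → k) : G v = 0 := by
  classical
  induction d generalizing G S with
  | zero =>
    obtain ⟨c, hc⟩ := hG
    obtain ⟨P, hP⟩ := Finset.card_pos.mp hS
    rw [hc, ← hc P.rep, h0 P hP]
  | succ d ih =>
    obtain ⟨P, hP⟩ := Finset.card_pos.mp (by omega : 0 < S.card)
    obtain ⟨G', hG', h⟩ := hG.factor (h0 P hP)
    rw [h, ih hG' (S.erase P) (by rw [Finset.card_erase_of_mem hP]; omega), mul_zero]
    intro Q hQ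
    rw [Finset.mem_erase] at hQ
    have := h0 Q hQ.2
    rw [h] at this
    exact (mul_eq_zero.mp this).resolve_left (ell_ne_zero hQ.1.symm)

theorem IsForm.exists_one (P : Proj1 k) (d : ℕ) : ∃ G, IsForm d G ∧ G P.rep = 1 := by
  obtain ⟨a, b, hab⟩ := exists_lin P
  induction d with
  | zero => exact ⟨fun _ => 1, ⟨1, fun _ => rfl⟩, rfl⟩
  | succ d ih =>
    obtain ⟨G, hG, h⟩ := ih
    exact ⟨_, hG.linmul a b, by simp [h, hab]⟩

theorem IsForm.ellprod (S : Finset (Proj1 k)) {d : ℕ} {G : (Fin 2 → k) → k} (hG : IsForm d G) :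
    IsForm (d + S.card) (fun v => (∏ P ∈ S, ell P v) * G v) := by
  classical
  induction S using Finset.induction_on with
  | empty => simpa using hG
  | insert P S hP ih =>
    rw [Finset.card_insert_of_notMem hP, ← add_assoc]
    exact (ih.ellmul P).congr (fun v => by rw [Finset.prod_insert hP, mul_assoc])

/-- Separators on `ℙ¹`. -/
theorem IsForm.exists_sep (S : Finset (Proj1 k)) (P : Proj1 k) (hP : P ∉ S) (d : ℕ)
    (hd : S.card ≤ d) : ∃ G, IsForm d G ∧ G P.rep = 1 ∧ ∀ Q ∈ S, G Q.rep = 0 := by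
  obtain ⟨G, hG, h1⟩ := IsForm.exists_one P (d - S.card)
  have hne : ∏ Q ∈ S, ell Q P.rep ≠ 0 :=
    Finset.prod_ne_zero_iff.mpr (fun Q hQ => ell_ne_zero (fun h => hP (h ▸ hQ)))
  have h := (hG.ellprod S).smul (∏ Q ∈ S, ell Q P.rep)⁻¹
  rw [Nat.sub_add_cancel hd] at h
  refine ⟨_, h, by simp [h1, hne], fun Q hQ => ?_⟩
  have hz : ∏ Q' ∈ S, ell Q' Q.rep = 0 := Finset.prod_eq_zero hQ (ell_self Q)
  simp [hz]

/-- Interpolation on `ℙ¹`. -/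
theorem IsForm.interp (S : Finset (Proj1 k)) (c : Proj1 k → k) (d : ℕ)
    (hd : S.card ≤ d + 1) : ∃ G, IsForm d G ∧ ∀ Q ∈ S, G Q.rep = c Q := by
  classical
  induction S using Finset.induction_on with
  | empty => exact ⟨_, IsForm.zero d, by simp⟩
  | insert P S hP ih =>
    rw [Finset.card_insert_of_notMem hP] at hd
    obtain ⟨G, hG, h⟩ := ih (by omega)
    obtain ⟨H, hH, h1, h0⟩ := IsForm.exists_sep S P hP d (by omega)
    refine ⟨_, hG.add (hH.smul (c P - G P.rep)), fun Q hQ => ?_⟩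
    rcases Finset.mem_insert.mp hQ with rfl | hQ
    · simp [h1]
    · simp [h0 Q hQ, h Q hQ]

end ACMStar

namespace ACMStar

open Polynomial in
/-- Restriction of a polynomial to the plane `k p × k q`. -/
noncomputable def phi (p q : Fin 2 → k) : BiPoly k →ₐ[k] Polynomial (Polynomial k) :=
  MvPolynomial.aeval (Sum.elim (fun n => C (C (p n)) * X) (fun n => C (C (q n) * X)))

theorem phi_C (p q : Fin 2 → k) (a : k) :
    phi p q (MvPolynomial.C a) = Polynomial.C (Polynomial.C a) := by
  simp only [phi, MvPolynomial.aeval_C]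
  rfl

theorem phi_inl (p q : Fin 2 → k) (n : Fin 2) :
    phi p q (MvPolynomial.X (Sum.inl n)) = Polynomial.C (Polynomial.C (p n)) * Polynomial.X := by
  simp [phi]

theorem phi_inr (p q : Fin 2 → k) (n : Fin 2) :
    phi p q (MvPolynomial.X (Sum.inr n)) = Polynomial.C (Polynomial.C (q n) * Polynomial.X) := by
  simp [phi]

/-- The bihomogeneous component of bidegree `(i,j)`, evaluated at `(p,q)`. -/
noncomputable def coef (F : BiPoly k) (i j : ℕ) (p q : Fin 2 → k) : k :=
  ((phi p q F).coeff i).coeff j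

theorem coef_add (F G : BiPoly k) (i j : ℕ) (p q : Fin 2 → k) :
    coef (F + G) i j p q = coef F i j p q + coef G i j p q := by
  simp [coef]

theorem coef_C (a : k) (i j : ℕ) (p q : Fin 2 → k) :
    coef (MvPolynomial.C a) i j p q = if i = 0 ∧ j = 0 then a else 0 := by
  simp only [coef, phi_C, Polynomial.coeff_C]
  split_ifs with h1 h2 h3 <;> simp_all [Polynomial.coeff_C]

theorem coef_mul_inl_zero (F : BiPoly k) (n : Fin 2) (j : ℕ) (p q : Fin 2 → k) :
    coef (F * MvPolynomial.X (Sum.inl n)) 0 j p q = 0 := by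
  simp [coef, phi_inl, ← mul_assoc]

theorem coef_mul_inl_succ (F : BiPoly k) (n : Fin 2) (i j : ℕ) (p q : Fin 2 → k) :
    coef (F * MvPolynomial.X (Sum.inl n)) (i + 1) j p q = p n * coef F i j p q := by
  simp only [coef, phi_inl, map_mul, ← mul_assoc, Polynomial.coeff_mul_X, Polynomial.coeff_mul_C]
  ring

theorem coef_mul_inr_zero (F : BiPoly k) (n : Fin 2) (i : ℕ) (p q : Fin 2 → k) :
    coef (F * MvPolynomial.X (Sum.inr n)) i 0 p q = 0 := by
  simp [coef, phi_inr, ← mul_assoc]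

theorem coef_mul_inr_succ (F : BiPoly k) (n : Fin 2) (i j : ℕ) (p q : Fin 2 → k) :
    coef (F * MvPolynomial.X (Sum.inr n)) i (j + 1) p q = q n * coef F i j p q := by
  simp only [coef, phi_inr, map_mul, Polynomial.coeff_mul_C, ← mul_assoc, Polynomial.coeff_mul_X]
  ring

theorem coef_form_x (F : BiPoly k) (i j : ℕ) (q : Fin 2 → k) :
    IsForm i (fun p => coef F i j p q) := by
  induction F using MvPolynomial.induction_on generalizing i j with
  | C a =>
    cases i with
    | zero => exact ⟨if j = 0 then a else 0, fun v => by simp [coef_C]⟩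
    | succ i => exact (IsForm.zero (i + 1)).congr (fun v => by simp [coef_C])
  | add F G hF hG => exact ((hF i j).add (hG i j)).congr (fun v => coef_add ..)
  | mul_X F n hF =>
    rcases n with n | n
    · cases i with
      | zero => exact (IsForm.zero 0).congr (fun v => coef_mul_inl_zero ..)
      | succ i => exact ((hF i j).coordmul n).congr (fun v => coef_mul_inl_succ ..)
    · cases j with
      | zero => exact (IsForm.zero i).congr (fun v => coef_mul_inr_zero ..)
      | succ j => exact ((hF i j).smul (q n)).congr (fun v => coef_mul_inr_succ ..)

theorem coef_form_y (F : BiPoly k) (i j : ℕ) (p : Fin 2 → k) :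
    IsForm j (fun q => coef F i j p q) := by
  induction F using MvPolynomial.induction_on generalizing i j with
  | C a =>
    cases j with
    | zero => exact ⟨if i = 0 then a else 0, fun v => by simp [coef_C]⟩
    | succ i => exact (IsForm.zero (i + 1)).congr (fun v => by simp [coef_C])
  | add F G hF hG => exact ((hF i j).add (hG i j)).congr (fun v => coef_add ..)
  | mul_X F n hF =>
    rcases n with n | n
    · cases i with
      | zero => exact (IsForm.zero j).congr (fun v => coef_mul_inl_zero ..)
      | succ i => exact ((hF i j).smul (p n)).congr (fun v => coef_mul_inl_succ ..)
    · cases j with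
      | zero => exact (IsForm.zero 0).congr (fun v => coef_mul_inr_zero ..)
      | succ j => exact ((hF i j).coordmul n).congr (fun v => coef_mul_inr_succ ..)

theorem lift_x {i : ℕ} {G : (Fin 2 → k) → k} (hG : IsForm i G) :
    ∃ F : BiPoly k, ∀ p q, phi p q F =
      Polynomial.C (Polynomial.C (G p)) * Polynomial.X ^ i := by
  induction i generalizing G with
  | zero =>
    obtain ⟨c, hc⟩ := hG
    exact ⟨MvPolynomial.C c, fun p q => by simp [hc]⟩
  | succ i ih =>
    obtain ⟨G₁, G₂, h1, h2, h⟩ := hG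
    obtain ⟨F₁, hF₁⟩ := ih h1
    obtain ⟨F₂, hF₂⟩ := ih h2
    refine ⟨MvPolynomial.X (Sum.inl 0) * F₁ + MvPolynomial.X (Sum.inl 1) * F₂, fun p q => ?_⟩
    simp only [map_add, map_mul, hF₁, hF₂, phi_inl, h]
    ring

theorem lift_y {i : ℕ} {G : (Fin 2 → k) → k} (hG : IsForm i G) :
    ∃ F : BiPoly k, ∀ p q, phi p q F =
      Polynomial.C (Polynomial.C (G q) * Polynomial.X ^ i) := by
  induction i generalizing G with
  | zero =>
    obtain ⟨c, hc⟩ := hG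
    exact ⟨MvPolynomial.C c, fun p q => by simp [hc]⟩
  | succ i ih =>
    obtain ⟨G₁, G₂, h1, h2, h⟩ := hG
    obtain ⟨F₁, hF₁⟩ := ih h1
    obtain ⟨F₂, hF₂⟩ := ih h2
    refine ⟨MvPolynomial.X (Sum.inr 0) * F₁ + MvPolynomial.X (Sum.inr 1) * F₂, fun p q => ?_⟩
    simp only [map_add, map_mul, hF₁, hF₂, phi_inr, h, map_pow]
    ring

theorem lift_xy {i j : ℕ} {G H : (Fin 2 → k) → k} (hG : IsForm i G) (hH : IsForm j H) :
    ∃ F : BiPoly k, ∀ p q, phi p q F =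
      Polynomial.monomial i (Polynomial.monomial j (G p * H q)) := by
  obtain ⟨F₁, h1⟩ := lift_x hG
  obtain ⟨F₂, h2⟩ := lift_y hH
  refine ⟨F₁ * F₂, fun p q => ?_⟩
  rw [map_mul, h1, h2, ← Polynomial.C_mul_X_pow_eq_monomial, ← Polynomial.C_mul_X_pow_eq_monomial]
  simp only [map_mul]
  ring

theorem phi_surjective (P Q : Proj1 k) : Function.Surjective (phi P.rep Q.rep) := by
  intro f
  induction f using Polynomial.induction_on' with
  | add f g hf hg =>
    obtain ⟨F, rfl⟩ := hf
    obtain ⟨G, rfl⟩ := hg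
    exact ⟨F + G, map_add _ _ _⟩
  | monomial i f =>
    induction f using Polynomial.induction_on' with
    | add f g hf hg =>
      obtain ⟨F, hF⟩ := hf
      obtain ⟨G, hG⟩ := hg
      exact ⟨F + G, by rw [map_add, map_add, hF, hG]⟩
    | monomial j c =>
      obtain ⟨G, hG, hG1⟩ := IsForm.exists_one P i
      obtain ⟨H, hH, hH1⟩ := IsForm.exists_one Q j
      obtain ⟨F, hF⟩ := lift_xy (hG.smul c) hH
      exact ⟨F, by rw [hF, hG1, hH1, mul_one, mul_one]⟩

theorem evalEval_phi (p q : Fin 2 → k) (s t : k) (F : BiPoly k) :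
    Polynomial.evalEval t s (phi p q F) = MvPolynomial.eval (Sum.elim (s • p) (t • q)) F := by
  induction F using MvPolynomial.induction_on with
  | C a => simp
  | add F G hF hG => simp [hF, hG, Polynomial.evalEval_add]
  | mul_X F n hF =>
    rcases n with n | n
    · rw [map_mul, map_mul, Polynomial.evalEval_mul, phi_inl, Polynomial.evalEval_mul, hF]
      simp [mul_comm s]
    · rw [map_mul, map_mul, Polynomial.evalEval_mul, phi_inr, Polynomial.evalEval_C, hF]
      simp [mul_comm t]

theorem evalEval_ext [Infinite k] {f : Polynomial (Polynomial k)}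
    (h : ∀ s t : k, s ≠ 0 → t ≠ 0 → Polynomial.evalEval t s f = 0) : f = 0 := by
  have key : Polynomial.X * Polynomial.C Polynomial.X * f = 0 := by
    apply Polynomial.eq_zero_of_infinite_isRoot
    refine (Set.infinite_range_of_injective (Polynomial.C_injective (R := k))).mono ?_
    rintro _ ⟨s, rfl⟩
    change Polynomial.eval (Polynomial.C s) _ = 0
    apply Polynomial.funext
    intro t
    change Polynomial.evalEval t s _ = _
    rw [Polynomial.evalEval_mul, Polynomial.evalEval_mul, Polynomial.evalEval_X,
      Polynomial.evalEval_C, Polynomial.eval_X, Polynomial.eval_zero]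
    by_cases hs : s = 0
    · simp [hs]
    by_cases ht : t = 0
    · simp [ht]
    rw [h s t hs ht, mul_zero]
  simpa [Polynomial.X_ne_zero] using key

theorem vanishesAt_iff [Infinite k] (F : BiPoly k) (T : Proj1 k × Proj1 k) :
    VanishesAt F T ↔ phi T.1.rep T.2.rep F = 0 := by
  constructor
  · intro h
    apply evalEval_ext
    intro s t hs ht
    rw [evalEval_phi]
    apply h _ _ (smul_ne_zero hs T.1.rep_nonzero) (smul_ne_zero ht T.2.rep_nonzero)
    · conv_rhs => rw [← T.1.mk_rep]
      rw [Projectivization.mk_eq_mk_iff']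
      exact ⟨s, rfl⟩
    · conv_rhs => rw [← T.2.mk_rep]
      rw [Projectivization.mk_eq_mk_iff']
      exact ⟨t, rfl⟩
  · intro h p q hp hq h1 h2
    rw [← T.1.mk_rep, Projectivization.mk_eq_mk_iff'] at h1
    rw [← T.2.mk_rep, Projectivization.mk_eq_mk_iff'] at h2
    obtain ⟨s, rfl⟩ := h1
    obtain ⟨t, rfl⟩ := h2
    rw [← evalEval_phi, h, Polynomial.evalEval_zero]

theorem mem_vanishingIdeal_iff [Infinite k] (X : Finset (Proj1 k × Proj1 k)) (F : BiPoly k) :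
    F ∈ vanishingIdeal X ↔ ∀ T ∈ X, phi T.1.rep T.2.rep F = 0 := by
  change (∀ P ∈ X, VanishesAt F P) ↔ _
  simp only [vanishesAt_iff]

end ACMStar

namespace ACMStar

open RingTheory.Sequence in
theorem length_le_supportDim {A : Type*} [CommRing A] [IsNoetherianRing A] (rs : List A) :
    ∀ {M : Type _} [AddCommGroup M] [Module A M] [Module.Finite A M], IsRegular M rs →
    (rs.length : WithBot ℕ∞) ≤ Module.supportDim A M := by
  induction rs with
  | nil =>
    intro M _ _ _ h
    have := h.nontrivial
    have h0 := Module.supportDim_ne_bot_of_nontrivial A M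
    rw [← WithBot.coe_unbot _ h0]
    exact WithBot.coe_le_coe.mpr zero_le
  | cons a rs ih =>
    intro M _ _ _ h
    rw [isRegular_cons_iff] at h
    have h1 := ih h.2
    have h2 := Module.supportDim_quotSMulTop_succ_le_of_notMem_minimalPrimes (M := M) (x := a)
      (fun _ ↦ h.1.notMem_of_mem_minimalPrimes)
    refine le_trans ?_ h2
    rw [List.length_cons, Nat.cast_add, Nat.cast_one]
    gcongr

open RingTheory.Sequence in
theorem regular_pair {A : Type*} [CommRing A] {a b : A} (h : IsRegular A [a, b]) :
    (∀ x, a * x = 0 → x = 0) ∧ ∀ u v, b * u = a * v → ∃ w, u = a * w := by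
  have h1 := h.1
  rw [isWeaklyRegular_cons_iff, isWeaklyRegular_singleton_iff] at h1
  refine ⟨fun x hx => ?_, fun u v huv => ?_⟩
  · exact h1.1 (by simpa using hx)
  · have h2 := h1.2
    have : (Submodule.Quotient.mk u : QuotSMulTop a A) = 0 := by
      apply h2
      simp only [smul_zero]
      rw [← Submodule.Quotient.mk_smul, Submodule.Quotient.mk_eq_zero]
      rw [Submodule.mem_smul_pointwise_iff_exists]
      exact ⟨v, trivial, huv.symm⟩
    rw [Submodule.Quotient.mk_eq_zero, Submodule.mem_smul_pointwise_iff_exists] at this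
    obtain ⟨w, -, hw⟩ := this
    exact ⟨w, hw.symm⟩

open RingTheory.Sequence in
theorem regular_pair_mk {A : Type*} [CommRing A] {a b : A} {m : Ideal A} (hm : m ≠ ⊤)
    (ha : a ∈ m) (hb : b ∈ m) (h1 : ∀ x, a * x = 0 → x = 0)
    (h2 : ∀ u v, b * u = a * v → ∃ w, u = a * w) : IsRegular A [a, b] := by
  constructor
  · rw [isWeaklyRegular_cons_iff, isWeaklyRegular_singleton_iff]
    constructor
    · intro x y hxy
      have := h1 (x - y) (by simp only [smul_eq_mul] at hxy; rw [mul_sub, hxy, sub_self])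
      exact sub_eq_zero.mp this
    · rw [isSMulRegular_iff_right_eq_zero_of_smul]
      intro x hx
      obtain ⟨u, rfl⟩ := Submodule.Quotient.mk_surjective _ x
      rw [← Submodule.Quotient.mk_smul, Submodule.Quotient.mk_eq_zero,
        Submodule.mem_smul_pointwise_iff_exists] at hx
      obtain ⟨v, -, hv⟩ := hx
      obtain ⟨w, hw⟩ := h2 u v hv.symm
      rw [Submodule.Quotient.mk_eq_zero, Submodule.mem_smul_pointwise_iff_exists]
      exact ⟨w, trivial, hw.symm⟩
  · intro h
    apply hm
    rw [eq_top_iff, h]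
    refine Submodule.smul_le.mpr ?_
    intro r hr n _
    have : Ideal.ofList [a, b] ≤ m := by
      rw [Ideal.ofList, Ideal.span_le]
      intro x hx
      simp only [List.mem_cons, List.not_mem_nil, or_false, Set.mem_ofPred_eq] at hx
      rcases hx with rfl | rfl
      · exact ha
      · exact hb
    exact m.mul_mem_right _ (this hr)

section
variable [Infinite k] (X : Finset (Proj1 k × Proj1 k))

/-- The restriction map of the coordinate ring to the product of the planes. -/
noncomputable def psi : (BiPoly k ⧸ vanishingIdeal X) →+* (X → Polynomial (Polynomial k)) :=
  Ideal.Quotient.lift (vanishingIdeal X)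
    (RingHom.pi fun T : X => (phi T.1.1.rep T.1.2.rep : BiPoly k →+* Polynomial (Polynomial k)))
    (fun F hF => by
      rw [mem_vanishingIdeal_iff] at hF
      funext T
      exact hF T.1 T.2)

theorem psi_mk (F : BiPoly k) (T : X) :
    psi X (Ideal.Quotient.mk _ F) T = phi T.1.1.rep T.1.2.rep F := rfl

theorem psi_injective : Function.Injective (psi X) := by
  rw [injective_iff_map_eq_zero]
  intro x hx
  obtain ⟨F, rfl⟩ := Ideal.Quotient.mk_surjective x
  rw [Ideal.Quotient.eq_zero_iff_mem, mem_vanishingIdeal_iff]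
  intro T hT
  exact congrFun hx ⟨T, hT⟩

variable {X}

theorem irrelevant_ne_top (hX : X.Nonempty) : irrelevantIdeal X ≠ ⊤ := by
  obtain ⟨T, hT⟩ := hX
  intro h
  let e : (BiPoly k ⧸ vanishingIdeal X) →+* k :=
    Ideal.Quotient.lift (vanishingIdeal X) (MvPolynomial.eval 0) (fun F hF => by
      rw [mem_vanishingIdeal_iff] at hF
      have := evalEval_phi T.1.rep T.2.rep 0 0 F
      rw [hF T hT, Polynomial.evalEval_zero] at this
      rw [this]
      congr 1
      congr 1
      funext n
      rcases n with n | n <;> simp)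
  have h1 : irrelevantIdeal X ≤ RingHom.ker e := by
    rw [irrelevantIdeal, Ideal.map_le_iff_le_comap, Ideal.span_le]
    rintro _ ⟨n, rfl⟩
    change e (Ideal.Quotient.mk _ (MvPolynomial.X n)) = 0
    simp [e]
  rw [h, top_le_iff] at h1
  exact RingHom.ker_ne_top e h1

theorem dim_le : ringKrullDim (BiPoly k ⧸ vanishingIdeal X) ≤ 2 := by
  have h2 : ringKrullDim (Polynomial (Polynomial k)) = 2 := by
    rw [Polynomial.ringKrullDim_of_isNoetherianRing, Polynomial.ringKrullDim_of_isNoetherianRing,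
      ringKrullDim_eq_zero_of_field]
    rfl
  rw [ringKrullDim_quotient]
  refine iSup_le fun s => ?_
  have h0 := s.head.2
  rw [PrimeSpectrum.mem_zeroLocus, SetLike.coe_subset_coe] at h0
  have h1 : (∏ T ∈ X, RingHom.ker (phi T.1.rep T.2.rep)) ≤ s.head.1.asIdeal := by
    refine le_trans ?_ h0
    refine Ideal.prod_le_inf.trans ?_
    intro F hF
    rw [mem_vanishingIdeal_iff]
    intro T hT
    rw [Submodule.mem_finsetInf] at hF
    exact hF T hT
  obtain ⟨T, hT, hle⟩ := (Ideal.IsPrime.prod_le s.head.1.2).mp h1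
  rw [← h2]
  have e := RingHom.quotientKerEquivOfSurjective (f := (phi T.1.rep T.2.rep :
    BiPoly k →+* Polynomial (Polynomial k))) (phi_surjective T.1 T.2)
  rw [← ringKrullDim_eq_of_ringEquiv e, ringKrullDim_quotient]
  let s' : LTSeries (PrimeSpectrum.zeroLocus ((RingHom.ker (phi T.1.rep T.2.rep :
    BiPoly k →+* Polynomial (Polynomial k)) : Ideal (BiPoly k)) : Set (BiPoly k))) :=
    { length := s.length
      toFun := fun i => ⟨(s i).1, by
        rw [PrimeSpectrum.mem_zeroLocus, SetLike.coe_subset_coe]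
        exact hle.trans (s.monotone (Fin.zero_le i))⟩
      step := fun i => s.step i }
  exact le_iSup (fun t : LTSeries _ => (t.length : WithBot ℕ∞)) s'

open RingTheory.Sequence in
theorem regular_length_le (rs : List (BiPoly k ⧸ vanishingIdeal X))
    (h : IsRegular (BiPoly k ⧸ vanishingIdeal X) rs) : rs.length ≤ 2 := by
  have h1 := length_le_supportDim rs h
  rw [Module.supportDim_self_eq_ringKrullDim] at h1
  have := h1.trans dim_le
  exact_mod_cast this

theorem exists_separator (T : X) : ∃ F : BiPoly k, phi T.1.1.rep T.1.2.rep F ≠ 0 ∧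
    ∀ T' : X, T' ≠ T → phi T'.1.1.rep T'.1.2.rep F = 0 := by
  classical
  obtain ⟨G, hG, hG1, hG0⟩ := IsForm.exists_sep ((X.image Prod.fst).erase T.1.1) T.1.1
    (by simp) _ le_rfl
  obtain ⟨H, hH, hH1, hH0⟩ := IsForm.exists_sep ((X.image Prod.snd).erase T.1.2) T.1.2
    (by simp) _ le_rfl
  obtain ⟨F, hF⟩ := lift_xy hG hH
  refine ⟨F, by rw [hF, hG1, hH1]; simp, fun T' hT' => ?_⟩
  rw [hF]
  by_cases h : T'.1.1 = T.1.1
  · rw [hH0 T'.1.2]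
    · simp
    · refine Finset.mem_erase.mpr ⟨fun h' => hT' (Subtype.ext (Prod.ext h h')), ?_⟩
      exact Finset.mem_image_of_mem _ T'.2
  · rw [hG0 T'.1.1]
    · simp
    · exact Finset.mem_erase.mpr ⟨h, Finset.mem_image_of_mem _ T'.2⟩

theorem nzd_psi_ne_zero {a : BiPoly k ⧸ vanishingIdeal X} (ha : ∀ x, a * x = 0 → x = 0) (T : X) :
    psi X a T ≠ 0 := by
  intro h0
  obtain ⟨F, hF, hF'⟩ := exists_separator T
  have h1 : Ideal.Quotient.mk (vanishingIdeal X) F = 0 := by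
    apply ha
    apply psi_injective X
    rw [map_mul, map_zero]
    funext T'
    by_cases h : T' = T
    · subst h
      simp [h0]
    · simp [psi_mk, hF' T' h]
  apply hF
  rw [← psi_mk, h1]
  simp

theorem saturation_one {a b : BiPoly k ⧸ vanishingIdeal X}
    (hab : RingTheory.Sequence.IsRegular (BiPoly k ⧸ vanishingIdeal X) [a, b])
    (f : X → Polynomial (Polynomial k)) (h1 : psi X a * f ∈ (psi X).range)
    (h2 : psi X b * f ∈ (psi X).range) : f ∈ (psi X).range := by
  obtain ⟨r1, r2⟩ := regular_pair hab
  obtain ⟨u, hu⟩ := h1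
  obtain ⟨v, hv⟩ := h2
  obtain ⟨w, rfl⟩ := r2 u v (by
    apply psi_injective X
    rw [map_mul, map_mul, hu, hv]
    ring)
  refine ⟨w, ?_⟩
  funext T
  have := congrFun hu T
  rw [map_mul, Pi.mul_apply, Pi.mul_apply] at this
  exact mul_left_cancel₀ (nzd_psi_ne_zero r1 T) this

theorem saturation {a b : BiPoly k ⧸ vanishingIdeal X} (ha : a ∈ irrelevantIdeal X)
    (hb : b ∈ irrelevantIdeal X)
    (hab : RingTheory.Sequence.IsRegular (BiPoly k ⧸ vanishingIdeal X) [a, b])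
    (f : X → Polynomial (Polynomial k)) (n : ℕ)
    (h : ∀ z ∈ irrelevantIdeal X ^ n, psi X z * f ∈ (psi X).range) : f ∈ (psi X).range := by
  induction n with
  | zero => simpa using h 1 (by simp)
  | succ n ih =>
    apply ih
    intro z hz
    apply saturation_one hab
    · rw [← mul_assoc, ← map_mul]
      exact h _ ((pow_succ' (irrelevantIdeal X) n).ge (Ideal.mul_mem_mul ha hz))
    · rw [← mul_assoc, ← map_mul]
      exact h _ ((pow_succ' (irrelevantIdeal X) n).ge (Ideal.mul_mem_mul hb hz))

/-- If a power of each variable multiplies `f` into the coordinate ring, and there is a regular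
sequence of length two, then `f` is in the coordinate ring. -/
theorem saturation_vars {a b : BiPoly k ⧸ vanishingIdeal X} (ha : a ∈ irrelevantIdeal X)
    (hb : b ∈ irrelevantIdeal X)
    (hab : RingTheory.Sequence.IsRegular (BiPoly k ⧸ vanishingIdeal X) [a, b])
    (f : X → Polynomial (Polynomial k)) (N : ℕ)
    (h : ∀ n, psi X (Ideal.Quotient.mk _ (MvPolynomial.X n)) ^ N * f ∈ (psi X).range) :
    f ∈ (psi X).range := by
  let I : Ideal (BiPoly k ⧸ vanishingIdeal X) :=
    { carrier := {z | psi X z * f ∈ (psi X).range}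
      add_mem' := fun {x y} hx hy => by
        rw [Set.mem_ofPred_eq] at hx hy ⊢
        rw [map_add, add_mul]
        exact add_mem hx hy
      zero_mem' := by
        rw [Set.mem_ofPred_eq]
        rw [map_zero, zero_mul]
        exact zero_mem _
      smul_mem' := fun c x hx => by
        rw [Set.mem_ofPred_eq] at hx ⊢
        rw [smul_eq_mul, map_mul, mul_assoc]
        exact mul_mem ⟨c, rfl⟩ hx }
  have h1 : irrelevantIdeal X ≤ I.radical := by
    rw [irrelevantIdeal, Ideal.map_le_iff_le_comap, Ideal.span_le]
    rintro _ ⟨n, rfl⟩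
    refine ⟨N, ?_⟩
    change _ ∈ {z | psi X z * f ∈ (psi X).range}
    rw [Set.mem_ofPred_eq, map_pow]
    exact h n
  obtain ⟨n, hn⟩ := Ideal.exists_pow_le_of_le_radical_of_fg h1 (IsNoetherian.noetherian _)
  exact saturation ha hb hab f n (fun z hz => by
    have h2 : z ∈ {z | psi X z * f ∈ (psi X).range} := hn hz
    rwa [Set.mem_ofPred_eq] at h2)

end

end ACMStar

namespace ACMStar

open Classical in
/-- The set of second coordinates of the points of `X` with first coordinate `P`. -/
noncomputable def row (X : Finset (Proj1 k × Proj1 k)) (P : Proj1 k) : Finset (Proj1 k) :=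
  (X.filter fun T => T.1 = P).image Prod.snd

theorem mem_row {X : Finset (Proj1 k × Proj1 k)} {P Q : Proj1 k} : Q ∈ row X P ↔ (P, Q) ∈ X := by
  classical
  simp only [row, Finset.mem_image, Finset.mem_filter, Prod.exists]
  constructor
  · rintro ⟨P', Q', ⟨h, rfl⟩, rfl⟩
    exact h
  · intro h
    exact ⟨P, Q, ⟨h, rfl⟩, rfl⟩

theorem star_iff_chain (X : Finset (Proj1 k × Proj1 k)) :
    PropertyStar X ↔ ∀ P P', row X P ⊆ row X P' ∨ row X P' ⊆ row X P := by
  constructor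
  · intro h P P'
    by_contra! hc
    obtain ⟨Q, hQ, hQ'⟩ := Finset.not_subset.mp hc.1
    obtain ⟨R, hR, hR'⟩ := Finset.not_subset.mp hc.2
    rw [mem_row] at *
    rcases h P Q P' R hQ hR (by rintro rfl; exact hQ' hQ) (by rintro rfl; exact hQ' hR) with h | h
    · exact hR' h
    · exact hQ' h
  · intro h P Q P' Q' h1 h2 _ _
    rcases h P P' with h | h
    · exact Or.inr (mem_row.mp (h (mem_row.mpr h1)))
    · exact Or.inl (mem_row.mp (h (mem_row.mpr h2)))

theorem mon_x (c h : k) (i j N : ℕ) :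
    (Polynomial.C (Polynomial.C c) * Polynomial.X) ^ N *
      Polynomial.monomial i (Polynomial.monomial j h) =
    Polynomial.monomial (i + N) (Polynomial.monomial j (c ^ N * h)) := by
  simp only [← Polynomial.C_mul_X_pow_eq_monomial, map_mul, map_pow]
  ring

theorem mon_y (c h : k) (i j N : ℕ) :
    (Polynomial.C (Polynomial.C c * Polynomial.X)) ^ N *
      Polynomial.monomial i (Polynomial.monomial j h) =
    Polynomial.monomial i (Polynomial.monomial (j + N) (c ^ N * h)) := by
  simp only [← Polynomial.C_mul_X_pow_eq_monomial, map_mul, map_pow]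
  ring

theorem exists_min_incomparable {X : Finset (Proj1 k × Proj1 k)} (h : ¬ PropertyStar X)
    [DecidableEq (Proj1 k)] :
    ∃ P₀ P₁, ¬ row X P₀ ⊆ row X P₁ ∧ ¬ row X P₁ ⊆ row X P₀ ∧
      ∀ P P', ¬ row X P ⊆ row X P' → ¬ row X P' ⊆ row X P →
        (row X P₀ ∩ row X P₁).card ≤ (row X P ∩ row X P').card := by
  classical
  rw [star_iff_chain] at h
  push Not at h
  have hex : ∃ n, ∃ P P', ¬ row X P ⊆ row X P' ∧ ¬ row X P' ⊆ row X P ∧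
      (row X P ∩ row X P').card = n := by
    obtain ⟨P, P', h1, h2⟩ := h
    exact ⟨_, P, P', h1, h2, rfl⟩
  obtain ⟨P, P', h1, h2, h3⟩ := Nat.find_spec hex
  refine ⟨P, P', h1, h2, fun R R' hR hR' => ?_⟩
  rw [h3]
  exact Nat.find_min' hex ⟨R, R', hR, hR', rfl⟩

theorem star_of_regular [Infinite k] {X : Finset (Proj1 k × Proj1 k)}
    {a b : BiPoly k ⧸ vanishingIdeal X} (ha : a ∈ irrelevantIdeal X)
    (hb : b ∈ irrelevantIdeal X)
    (hab : RingTheory.Sequence.IsRegular (BiPoly k ⧸ vanishingIdeal X) [a, b]) :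
    PropertyStar X := by
  classical
  by_contra hstar
  obtain ⟨P₀, P₁, h01, h10, hmin⟩ := exists_min_incomparable hstar
  set J := row X P₀ ∩ row X P₁ with hJ
  set T := (X.image Prod.fst).filter (fun P => P ≠ P₀ ∧ ¬ row X P ⊆ J) with hT
  obtain ⟨Q₀, hQ₀, hQ₀'⟩ := Finset.not_subset.mp h01
  have hP₁T : P₁ ∈ T := by
    obtain ⟨Q, hQ, hQ'⟩ := Finset.not_subset.mp h10
    rw [hT, Finset.mem_filter]
    refine ⟨Finset.mem_image.mpr ⟨_, mem_row.mp hQ, rfl⟩, ?_, ?_⟩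
    · rintro rfl
      exact hQ' hQ
    · intro h
      exact hQ' (Finset.mem_inter.mp (h hQ)).1
  have hP₀T : P₀ ∉ T := by simp [hT]
  have hJ0 : J.card < (row X P₀).card := by
    apply Finset.card_lt_card
    refine ⟨Finset.inter_subset_left, fun h => hQ₀' ?_⟩
    exact (Finset.mem_inter.mp (h hQ₀)).2
  have hJ1 : J.card < (row X P₁).card := by
    apply Finset.card_lt_card
    refine ⟨Finset.inter_subset_right, fun h => h10 ?_⟩
    exact fun Q hQ => (Finset.mem_inter.mp (h hQ)).1
  have hcard : ∀ P ∈ T, J.card < (row X P).card := by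
    intro P hP
    rw [hT, Finset.mem_filter] at hP
    obtain ⟨-, -, hPJ⟩ := hP
    by_cases c1 : row X P₀ ⊆ row X P
    · exact hJ0.trans_le (Finset.card_le_card c1)
    by_cases c2 : row X P₁ ⊆ row X P
    · exact hJ1.trans_le (Finset.card_le_card c2)
    by_cases c3 : row X P ⊆ row X P₀
    · by_cases c4 : row X P ⊆ row X P₁
      · exact absurd (Finset.subset_inter c3 c4) hPJ
      · refine (hmin P P₁ c4 c2).trans_lt (Finset.card_lt_card ⟨Finset.inter_subset_left, ?_⟩)
        exact fun h => c4 (h.trans Finset.inter_subset_right)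
    · refine (hmin P P₀ c3 c1).trans_lt (Finset.card_lt_card ⟨Finset.inter_subset_left, ?_⟩)
      exact fun h => c3 (h.trans Finset.inter_subset_right)
  obtain ⟨i, hi⟩ : ∃ i, T.card = i + 1 :=
    ⟨T.card - 1, by have := Finset.card_pos.mpr ⟨_, hP₁T⟩; omega⟩
  obtain ⟨H, hH, hH0, hH1⟩ : ∃ H, IsForm J.card H ∧ (∀ Q ∈ J, H Q.rep = 0) ∧
      ∀ Q : Proj1 k, Q ∉ J → H Q.rep ≠ 0 := by
    have h := IsForm.ellprod J (d := 0) (G := fun _ => 1) ⟨1, fun _ => rfl⟩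
    rw [zero_add] at h
    refine ⟨_, h, fun Q hQ => ?_, fun Q hQ => ?_⟩
    · rw [Finset.prod_eq_zero hQ (ell_self Q), zero_mul]
    · rw [mul_one, Finset.prod_ne_zero_iff]
      exact fun R hR => ell_ne_zero (fun h => hQ (h ▸ hR))
  let f : X → Polynomial (Polynomial k) := fun T =>
    if T.1.1 = P₀ then Polynomial.monomial i (Polynomial.monomial J.card (H T.1.2.rep)) else 0
  have hf : f ∈ (psi X).range := by
    apply saturation_vars ha hb hab f X.card
    rintro (n | n)
    · obtain ⟨G, hG, hG'⟩ := IsForm.interp (X.image Prod.fst)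
        (fun P => if P = P₀ then P₀.rep n ^ X.card else 0) (i + X.card)
        (by have := Finset.card_image_le (s := X) (f := Prod.fst); omega)
      obtain ⟨F, hF⟩ := lift_xy hG hH
      refine ⟨Ideal.Quotient.mk _ F, ?_⟩
      funext T
      rw [psi_mk, hF, Pi.mul_apply, Pi.pow_apply, psi_mk, phi_inl,
        hG' _ (Finset.mem_image_of_mem _ T.2)]
      by_cases h : T.1.1 = P₀
      · simp only [f, h, if_true, mon_x]
      · simp [f, h]
    · obtain ⟨G, hG, hG1, hG0⟩ := IsForm.exists_sep (T.erase P₁) P₀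
        (fun h => hP₀T (Finset.mem_of_mem_erase h)) i
        (by rw [Finset.card_erase_of_mem hP₁T]; omega)
      obtain ⟨W, hW, hW'⟩ := IsForm.interp (X.image Prod.snd)
        (fun Q => if Q ∈ row X P₀ then Q.rep n ^ X.card * H Q.rep else 0) (J.card + X.card)
        (by have := Finset.card_image_le (s := X) (f := Prod.snd); omega)
      obtain ⟨F, hF⟩ := lift_xy hG hW
      refine ⟨Ideal.Quotient.mk _ F, ?_⟩
      funext S
      rw [psi_mk, hF, Pi.mul_apply, Pi.pow_apply, psi_mk, phi_inr,
        hW' _ (Finset.mem_image_of_mem _ S.2)]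
      have hS : S.1.2 ∈ row X S.1.1 := mem_row.mpr S.2
      by_cases h : S.1.1 = P₀
      · rw [h] at hS
        simp only [f, h, if_true, mon_y, hS, hG1, one_mul]
      · have : G S.1.1.rep * (if S.1.2 ∈ row X P₀ then S.1.2.rep n ^ X.card * H S.1.2.rep else 0)
            = 0 := by
          by_cases h2 : S.1.1 ∈ T.erase P₁
          · rw [hG0 _ h2, zero_mul]
          · split_ifs with h3
            · rw [hH0, mul_zero, mul_zero]
              by_cases h4 : S.1.1 = P₁
              · rw [h4] at hS
                exact Finset.mem_inter.mpr ⟨h3, hS⟩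
              · by_contra h5
                apply h2
                rw [Finset.mem_erase, hT, Finset.mem_filter]
                exact ⟨h4, Finset.mem_image_of_mem _ S.2, h, fun h6 => h5 (h6 hS)⟩
            · rw [mul_zero]
        rw [this]
        simp [f, h]
  obtain ⟨w, hw⟩ := hf
  obtain ⟨F, rfl⟩ := Ideal.Quotient.mk_surjective w
  have hval : ∀ S (hS : S ∈ X), coef F i J.card S.1.rep S.2.rep =
      if S.1 = P₀ then H S.2.rep else 0 := by
    intro S hS
    have := congrFun hw ⟨S, hS⟩
    rw [psi_mk] at this
    rw [coef, this]
    by_cases h : S.1 = P₀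
    · simp [f, h]
    · simp [f, h]
  have hzero : ∀ P ∈ T, ∀ q, coef F i J.card P.rep q = 0 := by
    intro P hP q
    refine (coef_form_y F i J.card P.rep).eq_zero (row X P) (hcard P hP) (fun Q hQ => ?_) q
    rw [hval (P, Q) (mem_row.mp hQ), if_neg]
    rintro rfl
    exact hP₀T hP
  have h1 := (coef_form_x F i J.card Q₀.rep).eq_zero T (by omega)
    (fun P hP => hzero P hP Q₀.rep) P₀.rep
  have h2 := hval (P₀, Q₀) (mem_row.mp hQ₀)
  rw [if_pos rfl] at h2
  refine hH1 Q₀ (fun h => hQ₀' (Finset.mem_inter.mp h).2) ?_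
  rw [← h2]
  exact h1

end ACMStar

namespace ACMStar

theorem glue {X : Finset (Proj1 k × Proj1 k)} (hstar : PropertyStar X) (i j : ℕ)
    (c : Proj1 k → Proj1 k → k)
    (hrow : ∀ P, ∃ v, IsForm j v ∧ ∀ Q, (P, Q) ∈ X → c P Q = v Q.rep)
    (hcol : ∀ Q, ∃ w, IsForm i w ∧ ∀ P, (P, Q) ∈ X → c P Q = w P.rep) :
    ∃ F : BiPoly k, ∀ S ∈ X, phi S.1.rep S.2.rep F =
      Polynomial.monomial i (Polynomial.monomial j (c S.1 S.2)) := by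
  classical
  rw [star_iff_chain] at hstar
  have key : ∀ s : Finset (Proj1 k), ∃ F : BiPoly k,
      (∀ p q, phi p q F = Polynomial.monomial i (Polynomial.monomial j (coef F i j p q))) ∧
      ∀ P ∈ s, ∀ Q, (P, Q) ∈ X → coef F i j P.rep Q.rep = c P Q := by
    intro s
    induction s using Finset.induction_on_min_value (fun P => (row X P).card) with
    | empty => exact ⟨0, by simp [coef], by simp⟩
    | insert P s hP hmin ih =>
      obtain ⟨F, hF, hFc⟩ := ih
      have hsub : ∀ P' ∈ s, row X P ⊆ row X P' := by
        intro P' hP'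
        rcases hstar P P' with h | h
        · exact h
        · exact (Finset.eq_of_subset_of_card_le h (hmin P' hP')).ge
      have hd : ∀ Q, (P, Q) ∈ X → ∃ w, IsForm i w ∧ (∀ P' ∈ s, w P'.rep = 0) ∧
          w P.rep = c P Q - coef F i j P.rep Q.rep := by
        intro Q hQ
        obtain ⟨w, hw, hwc⟩ := hcol Q
        refine ⟨_, hw.add ((coef_form_x F i j Q.rep).smul (-1)), fun P' hP' => ?_, ?_⟩
        · have h1 : (P', Q) ∈ X := mem_row.mp (hsub P' hP' (mem_row.mpr hQ))
          rw [← hwc P' h1, hFc P' hP' Q h1]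
          ring
        · rw [← hwc P hQ]
          ring
      by_cases hs : i < s.card
      · refine ⟨F, hF, fun P' hP' Q hQ => ?_⟩
        rcases Finset.mem_insert.mp hP' with rfl | hP'
        · obtain ⟨w, hw, hw0, hw1⟩ := hd Q hQ
          have := hw.eq_zero s hs hw0 P'.rep
          rw [hw1] at this
          exact (sub_eq_zero.mp this).symm
        · exact hFc P' hP' Q hQ
      · obtain ⟨G, hG, hG1, hG0⟩ := IsForm.exists_sep s P hP i (by omega)
        obtain ⟨v, hv, hvc⟩ := hrow P
        obtain ⟨F', hF'⟩ := lift_xy hG (hv.add ((coef_form_y F i j P.rep).smul (-1)))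
        have hc' : ∀ p q, coef F' i j p q = G p * (v q + -1 * coef F i j P.rep q) := by
          intro p q
          rw [coef, hF']
          simp
        refine ⟨F + F', fun p q => ?_, fun P' hP' Q hQ => ?_⟩
        · rw [map_add, coef_add, map_add, map_add, ← hF, hc', hF']
        · rw [coef_add, hc']
          rcases Finset.mem_insert.mp hP' with rfl | hP'
          · rw [hG1, ← hvc Q hQ]
            ring
          · rw [hG0 P' hP', hFc P' hP' Q hQ]
            ring
  obtain ⟨F, hF, hFc⟩ := key (X.image Prod.fst)
  refine ⟨F, fun S hS => ?_⟩
  rw [hF, hFc S.1 (Finset.mem_image_of_mem _ hS) S.2 hS]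

theorem exists_bound {ι : Type*} [Fintype ι] (f : ι → Polynomial (Polynomial k)) :
    ∃ M : ℕ, ∀ T i j, (M ≤ i ∨ M ≤ j) → ((f T).coeff i).coeff j = 0 := by
  classical
  have h1 : ∀ T, ∃ M : ℕ, ∀ i j, (M ≤ i ∨ M ≤ j) → ((f T).coeff i).coeff j = 0 := by
    intro T
    refine ⟨(f T).natDegree + 1 + ((f T).support.sup fun i => ((f T).coeff i).natDegree) + 1, ?_⟩
    rintro i j (h | h)
    · rw [Polynomial.coeff_eq_zero_of_natDegree_lt (by omega : (f T).natDegree < i)]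
      simp
    · by_cases hi : i ∈ (f T).support
      · have := Finset.le_sup (f := fun i => ((f T).coeff i).natDegree) hi
        apply Polynomial.coeff_eq_zero_of_natDegree_lt
        omega
      · rw [Polynomial.notMem_support_iff.mp hi]
        simp
  choose M hM using h1
  refine ⟨Finset.univ.sup M, fun T i j h => hM T i j ?_⟩
  have := Finset.le_sup (f := M) (Finset.mem_univ T)
  omega

theorem exists_lin_ne (k : Type*) [Field k] [Infinite k] (S : Finset (Proj1 k)) :
    ∃ t : k, ∀ P ∈ S, P.rep 0 + t * P.rep 1 ≠ 0 := by
  classical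
  obtain ⟨t, ht⟩ := Infinite.exists_notMem_finset (S.image fun P => -P.rep 0 / P.rep 1)
  refine ⟨t, fun P hP h => ?_⟩
  by_cases h1 : P.rep 1 = 0
  · rcases rep_cases P with h0 | h0
    · apply h0
      simpa [h1] using h
    · exact h0 h1
  · apply ht
    refine Finset.mem_image.mpr ⟨P, hP, ?_⟩
    field_simp
    linear_combination -h

section
variable [Infinite k] {X : Finset (Proj1 k × Proj1 k)}

theorem range_of_star (hstar : PropertyStar X) (L L' : Proj1 k → k)
    (hL : ∀ S ∈ X, L S.1 ≠ 0) (hL' : ∀ S ∈ X, L' S.2 ≠ 0)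
    (f : X → Polynomial (Polynomial k)) (U V : BiPoly k)
    (hU : ∀ S : X, phi S.1.1.rep S.1.2.rep U =
      Polynomial.C (Polynomial.C (L S.1.1)) * Polynomial.X * f S)
    (hV : ∀ S : X, phi S.1.1.rep S.1.2.rep V =
      Polynomial.C (Polynomial.C (L' S.1.2) * Polynomial.X) * f S) :
    ∃ F : BiPoly k, ∀ S : X, phi S.1.1.rep S.1.2.rep F = f S := by
  classical
  have hij : ∀ i j : ℕ, ∃ F : BiPoly k, ∀ S : X, phi S.1.1.rep S.1.2.rep F =
      Polynomial.monomial i (Polynomial.monomial j (((f S).coeff i).coeff j)) := by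
    intro i j
    let c : Proj1 k → Proj1 k → k := fun P Q =>
      if h : (P, Q) ∈ X then ((f ⟨(P, Q), h⟩).coeff i).coeff j else 0
    have hrow : ∀ P, ∃ v, IsForm j v ∧ ∀ Q, (P, Q) ∈ X → c P Q = v Q.rep := by
      intro P
      refine ⟨_, (coef_form_y U (i + 1) j P.rep).smul (L P)⁻¹, fun Q hQ => ?_⟩
      have h := hU ⟨(P, Q), hQ⟩
      have hne := hL _ hQ
      simp only [coef]
      rw [h, mul_assoc, Polynomial.coeff_C_mul, Polynomial.coeff_X_mul, Polynomial.coeff_C_mul]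
      simp only [c]
      rw [dif_pos hQ]
      field_simp
    have hcol : ∀ Q, ∃ w, IsForm i w ∧ ∀ P, (P, Q) ∈ X → c P Q = w P.rep := by
      intro Q
      refine ⟨_, (coef_form_x V i (j + 1) Q.rep).smul (L' Q)⁻¹, fun P hP => ?_⟩
      have h := hV ⟨(P, Q), hP⟩
      have hne := hL' _ hP
      simp only [coef]
      rw [h, Polynomial.coeff_C_mul, mul_assoc, Polynomial.coeff_C_mul, Polynomial.coeff_X_mul]
      simp only [c]
      rw [dif_pos hP]
      field_simp
    obtain ⟨F, hF⟩ := glue hstar i j c hrow hcol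
    refine ⟨F, fun S => ?_⟩
    rw [hF S.1 S.2]
    simp only [c]
    rw [dif_pos S.2]
  choose F hF using hij
  obtain ⟨M, hM⟩ := exists_bound f
  refine ⟨∑ i ∈ Finset.range M, ∑ j ∈ Finset.range M, F i j, fun S => ?_⟩
  simp only [map_sum, hF]
  ext i j
  simp only [Polynomial.finsetSum_coeff, Polynomial.coeff_monomial]
  by_cases hi : i < M
  · by_cases hj : j < M
    · rw [Finset.sum_eq_single i]
      · simp only [if_true, Polynomial.coeff_monomial]
        simp [hj]
      · intro i' _ hi'
        simp [hi']
      · intro h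
        exact absurd (Finset.mem_range.mpr hi) h
    · rw [hM S i j (Or.inr (by omega))]
      apply Finset.sum_eq_zero
      intro i' _
      apply Finset.sum_eq_zero
      intro j' hj'
      rw [Finset.mem_range] at hj'
      split_ifs
      · rw [Polynomial.coeff_monomial, if_neg (by omega)]
      · simp
  · rw [hM S i j (Or.inl (by omega))]
    apply Finset.sum_eq_zero
    intro i' hi'
    apply Finset.sum_eq_zero
    intro j' _
    rw [Finset.mem_range] at hi'
    rw [if_neg (by omega)]
    simp

theorem regular_of_star (hX : X.Nonempty) (hstar : PropertyStar X) :
    ∃ a b : BiPoly k ⧸ vanishingIdeal X, a ∈ irrelevantIdeal X ∧ b ∈ irrelevantIdeal X ∧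
      RingTheory.Sequence.IsRegular (BiPoly k ⧸ vanishingIdeal X) [a, b] := by
  classical
  obtain ⟨t, ht⟩ := exists_lin_ne k (X.image Prod.fst)
  obtain ⟨t', ht'⟩ := exists_lin_ne k (X.image Prod.snd)
  let L : Proj1 k → k := fun P => P.rep 0 + t * P.rep 1
  let L' : Proj1 k → k := fun P => P.rep 0 + t' * P.rep 1
  have hL : ∀ S ∈ X, L S.1 ≠ 0 := fun S hS => ht _ (Finset.mem_image_of_mem _ hS)
  have hL' : ∀ S ∈ X, L' S.2 ≠ 0 := fun S hS => ht' _ (Finset.mem_image_of_mem _ hS)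
  let A : BiPoly k := MvPolynomial.X (Sum.inl 0) + MvPolynomial.C t * MvPolynomial.X (Sum.inl 1)
  let B : BiPoly k := MvPolynomial.X (Sum.inr 0) + MvPolynomial.C t' * MvPolynomial.X (Sum.inr 1)
  have hA : ∀ P Q : Proj1 k, phi P.rep Q.rep A =
      Polynomial.C (Polynomial.C (L P)) * Polynomial.X := by
    intro P Q
    simp only [A, L, map_add, map_mul, phi_inl, phi_C]
    ring
  have hB : ∀ P Q : Proj1 k, phi P.rep Q.rep B =
      Polynomial.C (Polynomial.C (L' Q) * Polynomial.X) := by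
    intro P Q
    simp only [B, L', map_add, map_mul, phi_inr, phi_C]
    ring
  have hmem : ∀ n, Ideal.Quotient.mk (vanishingIdeal X) (MvPolynomial.X n) ∈ irrelevantIdeal X :=
    fun n => Ideal.mem_map_of_mem _ (Ideal.subset_span ⟨n, rfl⟩)
  have hAne : ∀ S : X, phi S.1.1.rep S.1.2.rep A ≠ 0 := by
    intro S
    rw [hA]
    simp [hL S.1 S.2]
  have hAm : Ideal.Quotient.mk (vanishingIdeal X) A ∈ irrelevantIdeal X := by
    simp only [A, map_add, map_mul]
    exact add_mem (hmem _) (Ideal.mul_mem_left _ _ (hmem _))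
  have hBm : Ideal.Quotient.mk (vanishingIdeal X) B ∈ irrelevantIdeal X := by
    simp only [B, map_add, map_mul]
    exact add_mem (hmem _) (Ideal.mul_mem_left _ _ (hmem _))
  refine ⟨Ideal.Quotient.mk _ A, Ideal.Quotient.mk _ B, hAm, hBm,
    regular_pair_mk (irrelevant_ne_top hX) hAm hBm ?_ ?_⟩
  · intro x hx
    apply psi_injective X
    rw [map_zero]
    funext S
    have := congrFun (congrArg (psi X) hx) S
    rw [map_mul, Pi.mul_apply, psi_mk, map_zero, Pi.zero_apply] at this
    exact (mul_eq_zero.mp this).resolve_left (hAne S)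
  · intro u v huv
    obtain ⟨U, rfl⟩ := Ideal.Quotient.mk_surjective u
    obtain ⟨V, rfl⟩ := Ideal.Quotient.mk_surjective v
    have heq : ∀ S : X, phi S.1.1.rep S.1.2.rep B * phi S.1.1.rep S.1.2.rep U =
        phi S.1.1.rep S.1.2.rep A * phi S.1.1.rep S.1.2.rep V := by
      intro S
      have := congrFun (congrArg (psi X) huv) S
      rwa [map_mul, map_mul, Pi.mul_apply, Pi.mul_apply] at this
    have hf : ∀ S : X, ∃ f, phi S.1.1.rep S.1.2.rep U =
        Polynomial.C (Polynomial.C (L S.1.1)) * Polynomial.X * f := by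
      intro S
      have h0 : (phi S.1.1.rep S.1.2.rep U).coeff 0 = 0 := by
        have h := congrArg (fun g => Polynomial.coeff g 0) (heq S)
        simp only [hA, hB] at h
        rw [Polynomial.coeff_C_mul, mul_assoc (Polynomial.C (Polynomial.C (L S.1.1))),
          Polynomial.coeff_C_mul,
          Polynomial.coeff_X_mul_zero, mul_zero] at h
        refine (mul_eq_zero.mp h).resolve_left ?_
        simp [hL' S.1 S.2]
      obtain ⟨g, hg⟩ := Polynomial.X_dvd_iff.mpr h0
      refine ⟨Polynomial.C (Polynomial.C (L S.1.1)⁻¹) * g, ?_⟩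
      have h1 : Polynomial.C (Polynomial.C (L S.1.1)) *
          Polynomial.C (Polynomial.C (L S.1.1)⁻¹) = 1 := by
        rw [← Polynomial.C_mul, ← Polynomial.C_mul, mul_inv_cancel₀ (hL S.1 S.2)]
        simp
      rw [hg]
      linear_combination (-(Polynomial.X * g)) * h1
    choose f hf using hf
    obtain ⟨F, hF⟩ := range_of_star hstar L L' hL hL' f U V hf (by
      intro S
      apply mul_left_cancel₀ (hAne S)
      rw [← heq S, hf S, hB, hA]
      ring)
    refine ⟨Ideal.Quotient.mk _ F, ?_⟩
    apply psi_injective X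
    funext S
    rw [map_mul, Pi.mul_apply, psi_mk, psi_mk, psi_mk, hF, hA, hf]

theorem main (hX : X.Nonempty) : IsACM X ↔ PropertyStar X := by
  unfold IsACM depthWrt
  constructor
  · intro h
    set D := {n | ∃ rs : List (BiPoly k ⧸ vanishingIdeal X), rs.length = n ∧
      (∀ r ∈ rs, r ∈ irrelevantIdeal X) ∧
      RingTheory.Sequence.IsRegular (BiPoly k ⧸ vanishingIdeal X) rs} with hD
    have hne : D.Nonempty := by
      by_contra hne
      rw [Set.not_nonempty_iff_eq_empty] at hne
      rw [hne] at h
      simp at h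
    have hbdd : BddAbove D := by
      refine ⟨2, ?_⟩
      rintro n ⟨rs, rfl, -, hrs⟩
      exact regular_length_le rs hrs
    have hmem := Nat.sSup_mem hne hbdd
    rw [h] at hmem
    obtain ⟨rs, hlen, hm, hrs⟩ := hmem
    obtain ⟨a, b, rfl⟩ := List.length_eq_two.mp hlen
    exact star_of_regular (hm a (by simp)) (hm b (by simp)) hrs
  · intro h
    obtain ⟨a, b, ha, hb, hab⟩ := regular_of_star hX h
    apply IsGreatest.csSup_eq
    constructor
    · refine ⟨[a, b], rfl, ?_, hab⟩
      intro r hr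
      simp only [List.mem_cons, List.not_mem_nil, or_false] at hr
      rcases hr with rfl | rfl
      · exact ha
      · exact hb
    · rintro n ⟨rs, rfl, -, hrs⟩
      exact regular_length_le rs hrs

end

end ACMStar

/-- A finite set of points `X ⊆ ℙ¹×ℙ¹` is ACM (i.e. `depth (R/I_X) = 2`) if and only if
`X` satisfies property (*). -/
theorem acm_iff_propertyStar [IsAlgClosed k] [CharZero k]
    (X : Finset (Proj1 k × Proj1 k)) (hX : X.Nonempty) :
    IsACM X ↔ PropertyStar X := by
  have : Infinite k := CharZero.infinite k
  exact ACMStar.main hX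
end
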